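/- arXiv:2301.04601 — 9 statements merged into one kernel-verified Lean document; each statement's English description precedes it below -/
import Mathlib

section
/- Suppose φ : (0,∞) → [0,∞) is continuous, Φ(t) = ∫₀^t τ·φ(τ) dτ for t ≥ 0, and the function t ↦ Φ(√t) is convex on [0,∞). Then 2·Φ(t) ≤ t²·φ(t) for all t > 0. -/
/-- If `φ : (0,∞) → [0,∞)` is continuous, `Φ(t) = ∫₀ᵗ τ·φ(τ) dτ`, and `t ↦ Φ(√t)` is
convex on `[0,∞)`, then `2·Φ(t) ≤ t²·φ(t)` for all `t > 0`. -/
theorem stmt0 (φ Φ : ℝ → ℝ)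
    (hφc : ContinuousOn φ (Set.Ioi 0))
    (hφ0 : ∀ t > (0:ℝ), 0 ≤ φ t)
    (hΦ : ∀ t, Φ t = ∫ τ in (0:ℝ)..t, τ * φ τ)
    (hconv : ConvexOn ℝ (Set.Ici 0) (fun t => Φ (Real.sqrt t))) :
    ∀ t > (0:ℝ), 2 * Φ t ≤ t ^ 2 * φ t := by
  intro t ht
  by_cases hint : IntervalIntegrable (fun τ => τ * φ τ) MeasureTheory.volume 0 t
  · have hcont : ContinuousOn (fun τ => τ * φ τ) (Set.Ioi 0) := continuousOn_id.mul hφc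
    have hΦ' : HasDerivAt Φ (t * φ t) t := by
      rw [funext hΦ]
      exact intervalIntegral.integral_hasDerivAt_right hint
        (hcont.stronglyMeasurableAtFilter isOpen_Ioi t ht)
        (hcont.continuousAt (Ioi_mem_nhds ht))
    have hsqrt : Real.sqrt (t ^ 2) = t := Real.sqrt_sq ht.le
    have hderiv : HasDerivAt (fun s => Φ (Real.sqrt s)) (t * φ t * (1 / (2 * t))) (t ^ 2) := by
      have h := Real.hasDerivAt_sqrt (pow_pos ht 2).ne'
      rw [hsqrt] at h
      exact HasDerivAt.comp (t ^ 2) (hsqrt.symm ▸ hΦ') h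
    have hslope := hconv.slope_le_of_hasDerivAt (x := 0) (y := t ^ 2) Set.self_mem_Ici
      (Set.mem_Ici.2 (sq_nonneg t)) (pow_pos ht 2) hderiv
    have hΦ0 : Φ 0 = 0 := by simp [hΦ]
    rw [slope_def_field, hsqrt, Real.sqrt_zero, hΦ0, sub_zero, sub_zero,
      div_le_iff₀ (pow_pos ht 2)] at hslope
    have hval : t * φ t * (1 / (2 * t)) * t ^ 2 = t ^ 2 * φ t / 2 := by
      field_simp
    linarith
  · rw [hΦ, intervalIntegral.integral_undef hint, mul_zero]
    exact mul_nonneg (sq_nonneg t) (hφ0 t ht)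
end

section
/- Assume (φ₁), (φ₂) and (φ₃) with constants 1 < ℓ ≤ m < ∞, and set ℓ̃ = ℓ/(ℓ−1) and m̃ = m/(m−1). Then the Young conjugate Φ̃(t) = sup_{s ≥ 0} (t·s − Φ(s)) is finite for every t ≥ 0, and for all σ ≥ 0 and t ≥ 0 one has min(σ^{ℓ̃}, σ^{m̃})·Φ̃(t) ≤ Φ̃(σ·t) ≤ max(σ^{ℓ̃}, σ^{m̃})·Φ̃(t). -/
open Set in
/-- If `Φ (lam * s) ≤ lam ^ a * Φ s` for `lam = σ ^ (-1 / (a - 1))`, then the Young conjugate `Φ̃` of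
`Φ` satisfies `Φ̃ (σ * t) ≤ σ ^ (a / (a - 1)) * Φ̃ t`. -/
lemma sSup_youngConjugate_mul_le {Φ : ℝ → ℝ} {a σ t : ℝ} (ha : 1 < a) (hσ : 0 < σ)
    (hΦ : ∀ s ≥ (0 : ℝ), Φ (σ ^ (-1 / (a - 1)) * s) ≤ (σ ^ (-1 / (a - 1))) ^ a * Φ s)
    (hbdd : BddAbove ((fun s => t * s - Φ s) '' Ici 0)) :
    sSup ((fun s => (σ * t) * s - Φ s) '' Ici 0)
      ≤ σ ^ (a / (a - 1)) * sSup ((fun s => t * s - Φ s) '' Ici 0) := by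
  have ha' : a - 1 ≠ 0 := by linarith
  refine csSup_le (nonempty_Ici.image _) ?_
  rintro _ ⟨s, hs, rfl⟩
  have hs : 0 ≤ s := hs
  set lam := σ ^ (-1 / (a - 1)) with hlam
  have hlam0 : 0 < lam := Real.rpow_pos_of_pos hσ _
  set C := σ ^ (a / (a - 1)) with hC
  have hC0 : 0 < C := Real.rpow_pos_of_pos hσ _
  have hC_mul_lam : C * lam = σ := by
    rw [hC, hlam, ← Real.rpow_add hσ]
    conv_rhs => rw [← Real.rpow_one σ]
    congr 1
    field_simp
    ring
  have hC_mul_pow : C * lam ^ a = 1 := by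
    rw [hC, hlam, ← Real.rpow_mul hσ.le, ← Real.rpow_add hσ]
    conv_rhs => rw [← Real.rpow_zero σ]
    congr 1
    field_simp
    ring
  have hle : t * (lam * s) - Φ (lam * s) ≤ sSup ((fun s => t * s - Φ s) '' Ici 0) :=
    le_csSup hbdd ⟨lam * s, mul_nonneg hlam0.le hs, rfl⟩
  calc σ * t * s - Φ s = C * (t * (lam * s) - lam ^ a * Φ s) := by
        linear_combination (-t * s) * hC_mul_lam + Φ s * hC_mul_pow
    _ ≤ C * (t * (lam * s) - Φ (lam * s)) := by
        have := hΦ s hs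
        gcongr
    _ ≤ _ := by gcongr

lemma hasDerivAt_rpow_neg_mul {Φ g : ℝ → ℝ} (hderiv : ∀ t > (0 : ℝ), HasDerivAt Φ (g t) t)
    (a : ℝ) {x : ℝ} (hx : 0 < x) :
    HasDerivAt (fun t => t ^ (-a) * Φ t) (x ^ (-a - 1) * (x * g x - a * Φ x)) x := by
  have hpow : x ^ (-a) = x ^ (-a - 1) * x := by
    rw [← Real.rpow_add_one hx.ne']
    congr 1
    ring
  refine HasDerivAt.congr_deriv
    ((Real.hasDerivAt_rpow_const (p := -a) (Or.inl hx.ne')).mul (hderiv x hx)) ?_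
  rw [hpow]
  ring

open Set in
lemma monotoneOn_rpow_neg_mul {Φ g : ℝ → ℝ} (hderiv : ∀ t > (0 : ℝ), HasDerivAt Φ (g t) t)
    {a : ℝ} (h : ∀ t > (0 : ℝ), a * Φ t ≤ t * g t) :
    MonotoneOn (fun t => t ^ (-a) * Φ t) (Ioi 0) := by
  refine monotoneOn_of_hasDerivWithinAt_nonneg (convex_Ioi 0)
    (f' := fun x => x ^ (-a - 1) * (x * g x - a * Φ x))
    (fun x hx => (hasDerivAt_rpow_neg_mul hderiv a hx).continuousAt.continuousWithinAt) ?_ ?_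
  · intro x hx
    rw [interior_Ioi] at hx
    exact (hasDerivAt_rpow_neg_mul hderiv a hx).hasDerivWithinAt
  · intro x hx
    rw [interior_Ioi] at hx
    exact mul_nonneg (Real.rpow_nonneg (le_of_lt hx) _) (sub_nonneg.2 (h x hx))

open Set in
lemma antitoneOn_rpow_neg_mul {Φ g : ℝ → ℝ} (hderiv : ∀ t > (0 : ℝ), HasDerivAt Φ (g t) t)
    {a : ℝ} (h : ∀ t > (0 : ℝ), t * g t ≤ a * Φ t) :
    AntitoneOn (fun t => t ^ (-a) * Φ t) (Ioi 0) := by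
  have := monotoneOn_rpow_neg_mul (Φ := fun t => -Φ t) (g := fun t => -g t) (a := a)
    (fun t ht => (hderiv t ht).neg) (fun t ht => by linarith [h t ht])
  intro x hx y hy hxy
  have := this hx hy hxy
  simp only [mul_neg, neg_le_neg_iff] at this
  exact this

lemma apply_mul_le_rpow_mul {Φ : ℝ → ℝ} {a lam s : ℝ} (hlam : 0 < lam) (hs : 0 < s)
    (h : (lam * s) ^ (-a) * Φ (lam * s) ≤ s ^ (-a) * Φ s) : Φ (lam * s) ≤ lam ^ a * Φ s := by
  have hl : 0 < lam ^ a := Real.rpow_pos_of_pos hlam a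
  have hs' : 0 < s ^ (-a) := Real.rpow_pos_of_pos hs (-a)
  rw [Real.mul_rpow hlam.le hs.le, Real.rpow_neg hlam.le, mul_comm (lam ^ a)⁻¹, mul_assoc] at h
  exact (inv_mul_le_iff₀ hl).1 (le_of_mul_le_mul_left h hs')

open Set in
lemma hasDerivAt_of_eq_intervalIntegral {Φ g : ℝ → ℝ} (hg : ContinuousOn g (Ioi 0))
    (hΦ : ∀ t, Φ t = ∫ τ in (0 : ℝ)..t, g τ) (hpos : ∀ t > (0 : ℝ), 0 < Φ t)
    {t : ℝ} (ht : 0 < t) : HasDerivAt Φ (g t) t := by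
  have hint : IntervalIntegrable g MeasureTheory.volume 0 t := by
    by_contra hn
    have := hpos t ht
    rw [hΦ, intervalIntegral.integral_undef hn] at this
    exact lt_irrefl _ this
  rw [funext hΦ]
  exact intervalIntegral.integral_hasDerivAt_right hint
    (hg.stronglyMeasurableAtFilter isOpen_Ioi t ht) (hg.continuousAt (Ioi_mem_nhds ht))

/-- Under (φ₁)–(φ₃), the Young conjugate `Φ̃(t) = sup_{s ≥ 0} (t·s − Φ(s))` is finite
(for every `t ≥ 0` the defining set is bounded above), and for `ℓ̃ = ℓ/(ℓ−1)`,
`m̃ = m/(m−1)` one has `min(σ^ℓ̃, σ^m̃)·Φ̃(t) ≤ Φ̃(σt) ≤ max(σ^ℓ̃, σ^m̃)·Φ̃(t)`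
for all `σ, t ≥ 0`. -/
theorem stmt2 (φ Φ : ℝ → ℝ) (ℓ m : ℝ)
    (hφc : ContinuousOn φ (Set.Ioi 0))
    (hφ0 : ∀ t > (0:ℝ), 0 ≤ φ t)
    (hΦ : ∀ t, Φ t = ∫ τ in (0:ℝ)..t, τ * φ τ)
    (hφ1a : Filter.Tendsto (fun τ => τ * φ τ) (nhdsWithin 0 (Set.Ioi 0)) (nhds 0))
    (hφ1b : Filter.Tendsto (fun τ => τ * φ τ) Filter.atTop Filter.atTop)
    (hφ2 : MonotoneOn (fun τ => τ * φ τ) (Set.Ioi 0))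
    (hℓ : 1 < ℓ) (hℓm : ℓ ≤ m)
    (hφ3 : ∀ t > (0:ℝ), 0 < Φ t ∧ ℓ * Φ t ≤ t ^ 2 * φ t ∧ t ^ 2 * φ t ≤ m * Φ t) :
    (∀ t ≥ (0:ℝ), BddAbove ((fun s => t * s - Φ s) '' Set.Ici 0)) ∧
    (∀ σ ≥ (0:ℝ), ∀ t ≥ (0:ℝ),
      min (σ ^ (ℓ / (ℓ - 1))) (σ ^ (m / (m - 1))) *
          sSup ((fun s => t * s - Φ s) '' Set.Ici 0)
        ≤ sSup ((fun s => (σ * t) * s - Φ s) '' Set.Ici 0) ∧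
      sSup ((fun s => (σ * t) * s - Φ s) '' Set.Ici 0)
        ≤ max (σ ^ (ℓ / (ℓ - 1))) (σ ^ (m / (m - 1))) *
            sSup ((fun s => t * s - Φ s) '' Set.Ici 0)) := by
  have hm : 1 < m := hℓ.trans_le hℓm
  have hΦ0 : Φ 0 = 0 := by rw [hΦ, intervalIntegral.integral_same]
  have hΦnn : ∀ t ≥ (0:ℝ), 0 ≤ Φ t := fun t ht => by
    rcases eq_or_lt_of_le ht with rfl | ht
    · exact hΦ0.ge
    · exact (hφ3 t ht).1.le
  have hderiv : ∀ t > (0:ℝ), HasDerivAt Φ (t * φ t) t := fun t ht =>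
    hasDerivAt_of_eq_intervalIntegral (continuousOn_id.mul hφc) hΦ (fun t ht => (hφ3 t ht).1) ht
  have hbdd : ∀ t ≥ (0:ℝ), BddAbove ((fun s => t * s - Φ s) '' Set.Ici 0) := by
    intro t ht
    obtain ⟨S, hS⟩ := Filter.eventually_atTop.1 (hφ1b.eventually_ge_atTop (m * t))
    refine ⟨t * max S 0, ?_⟩
    rintro _ ⟨s, hs, rfl⟩
    have hs : 0 ≤ s := hs
    have hmax : 0 ≤ t * max S 0 := mul_nonneg ht (le_max_right _ _)
    rcases le_or_gt s (max S 0) with h | h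
    · have := mul_le_mul_of_nonneg_left h ht
      have := hΦnn s hs
      dsimp only
      linarith
    · have hs0 : 0 < s := (le_max_right S 0).trans_lt h
      have h1 := mul_le_mul_of_nonneg_left (hS s ((le_max_left S 0).trans h.le)) hs
      have h2 := (hφ3 s hs0).2.2
      have h3 : m * (t * s) ≤ m * Φ s := by linarith
      have := le_of_mul_le_mul_left h3 (by linarith)
      dsimp only
      linarith
  have hnn : ∀ t ≥ (0:ℝ), 0 ≤ sSup ((fun s => t * s - Φ s) '' Set.Ici 0) := fun t ht =>
    le_csSup (hbdd t ht) ⟨0, Set.self_mem_Ici, by simp [hΦ0]⟩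
  have hsmall : ∀ lam : ℝ, 0 < lam → lam ≤ 1 → ∀ s ≥ (0:ℝ), Φ (lam * s) ≤ lam ^ ℓ * Φ s := by
    intro lam hlam hlam1 s hs
    rcases eq_or_lt_of_le hs with rfl | hs
    · simp [hΦ0]
    · exact apply_mul_le_rpow_mul hlam hs <| monotoneOn_rpow_neg_mul hderiv
        (fun t ht => by linarith [(hφ3 t ht).2.1]) (mul_pos hlam hs) hs
        (mul_le_of_le_one_left hs.le hlam1)
  have hlarge : ∀ lam : ℝ, 1 ≤ lam → ∀ s ≥ (0:ℝ), Φ (lam * s) ≤ lam ^ m * Φ s := by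
    intro lam hlam1 s hs
    have hlam : 0 < lam := by linarith
    rcases eq_or_lt_of_le hs with rfl | hs
    · simp [hΦ0]
    · exact apply_mul_le_rpow_mul hlam hs <| antitoneOn_rpow_neg_mul hderiv
        (fun t ht => by linarith [(hφ3 t ht).2.2]) hs (mul_pos hlam hs)
        (le_mul_of_one_le_left hs.le hlam1)
  have hupper : ∀ σ > (0:ℝ), ∃ e, (e = ℓ / (ℓ - 1) ∨ e = m / (m - 1)) ∧ ∀ t ≥ (0:ℝ),
      sSup ((fun s => (σ * t) * s - Φ s) '' Set.Ici 0)
        ≤ σ ^ e * sSup ((fun s => t * s - Φ s) '' Set.Ici 0) := by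
    intro σ hσ
    rcases le_total 1 σ with h1 | h1
    · exact ⟨_, Or.inl rfl, fun t ht => sSup_youngConjugate_mul_le hℓ hσ
        (hsmall _ (Real.rpow_pos_of_pos hσ _) (Real.rpow_le_one_of_one_le_of_nonpos h1
          (div_nonpos_of_nonpos_of_nonneg (by norm_num) (by linarith)))) (hbdd t ht)⟩
    · exact ⟨_, Or.inr rfl, fun t ht => sSup_youngConjugate_mul_le hm hσ
        (hlarge _ (Real.one_le_rpow_of_pos_of_le_one_of_nonpos hσ h1
          (div_nonpos_of_nonpos_of_nonneg (by norm_num) (by linarith)))) (hbdd t ht)⟩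
  refine ⟨hbdd, fun σ hσ t ht => ?_⟩
  rcases eq_or_lt_of_le hσ with rfl | hσ
  · have h1 : ℓ / (ℓ - 1) ≠ 0 := (div_pos (by linarith) (by linarith)).ne'
    have h2 : m / (m - 1) ≠ 0 := (div_pos (by linarith) (by linarith)).ne'
    simp only [Real.zero_rpow h1, Real.zero_rpow h2, min_self, max_self, zero_mul]
    have h3 := hnn 0 le_rfl
    simp only [zero_mul] at h3
    refine ⟨h3, csSup_le (Set.nonempty_Ici.image _) ?_⟩
    rintro _ ⟨s, hs, rfl⟩
    have := hΦnn s hs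
    dsimp only
    linarith
  · constructor
    · obtain ⟨e, he, h⟩ := hupper σ⁻¹ (inv_pos.2 hσ)
      have h := h (σ * t) (mul_nonneg hσ.le ht)
      rw [inv_mul_cancel_left₀ hσ.ne', Real.inv_rpow hσ.le,
        le_inv_mul_iff₀ (Real.rpow_pos_of_pos hσ e)] at h
      refine le_trans (mul_le_mul_of_nonneg_right ?_ (hnn t ht)) h
      rcases he with rfl | rfl
      · exact min_le_left _ _
      · exact min_le_right _ _
    · obtain ⟨e, he, h⟩ := hupper σ hσ
      refine (h t ht).trans (mul_le_mul_of_nonneg_right ?_ (hnn t ht))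
      rcases he with rfl | rfl
      · exact le_max_left _ _
      · exact le_max_right _ _
end

section
/- Assume (φ₂): τ ↦ τ·φ(τ) is nondecreasing on (0,∞). Then for every t > 0 one has Φ̃(t·φ(t)) ≤ Φ(2t), i.e., sup_{s ≥ 0} (t·φ(t)·s − Φ(s)) ≤ Φ(2t). -/
/-- A nonnegative function that is nondecreasing on `[0, ∞)` has a primitive lying above the line of
slope `f t` through `(t, 0)`. -/
theorem MonotoneOn.mul_sub_le_integral {f : ℝ → ℝ} (hf : MonotoneOn f (Set.Ici 0))
    (hf0 : ∀ x, 0 ≤ x → 0 ≤ f x) {t u : ℝ} (ht : 0 ≤ t) (hu : 0 ≤ u) :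
    f t * (u - t) ≤ ∫ τ in (0:ℝ)..u, f τ := by
  have hint : ∀ a b : ℝ, 0 ≤ a → 0 ≤ b → IntervalIntegrable f MeasureTheory.volume a b :=
    fun a b ha hb => (hf.mono fun x hx => (le_min ha hb).trans hx.1).intervalIntegrable
  rcases le_total u t with h | h
  · exact (mul_nonpos_of_nonneg_of_nonpos (hf0 t ht) (sub_nonpos.2 h)).trans
      (intervalIntegral.integral_nonneg hu fun x hx => hf0 x hx.1)
  · rw [← intervalIntegral.integral_add_adjacent_intervals (hint 0 t le_rfl ht) (hint t u ht hu)]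
    have h1 : 0 ≤ ∫ τ in (0:ℝ)..t, f τ :=
      intervalIntegral.integral_nonneg ht fun x hx => hf0 x hx.1
    have h2 : ∫ _ in t..u, f t ≤ ∫ τ in t..u, f τ :=
      intervalIntegral.integral_mono_on h intervalIntegrable_const (hint t u ht hu)
        fun x hx => hf ht (ht.trans hx.1) hx.1
    rw [intervalIntegral.integral_const, smul_eq_mul] at h2
    linarith

/-- Under (φ₂), for every `t > 0` one has `Φ̃(t·φ(t)) ≤ Φ(2t)`, i.e.
`t·φ(t)·s − Φ(s) ≤ Φ(2t)` for all `s ≥ 0`. -/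
theorem stmt3 (φ Φ : ℝ → ℝ)
    (hφc : ContinuousOn φ (Set.Ioi 0))
    (hφ0 : ∀ t > (0:ℝ), 0 ≤ φ t)
    (hΦ : ∀ t, Φ t = ∫ τ in (0:ℝ)..t, τ * φ τ)
    (hφ2 : MonotoneOn (fun τ => τ * φ τ) (Set.Ioi 0)) :
    ∀ t > (0:ℝ), ∀ s ≥ (0:ℝ), t * φ t * s - Φ s ≤ Φ (2 * t) := by
  intro t ht s hs
  have h0 : ∀ x : ℝ, 0 ≤ x → 0 ≤ x * φ x := fun x hx => by
    rcases hx.eq_or_lt with rfl | hx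
    · simp
    · exact mul_nonneg hx.le (hφ0 x hx)
  have hmono : MonotoneOn (fun τ => τ * φ τ) (Set.Ici 0) := fun x hx y hy hxy => by
    rcases (Set.mem_Ici.1 hx).eq_or_lt with rfl | hx
    · simpa using h0 y hy
    · exact hφ2 hx (hx.trans_le hxy) hxy
  have h1 := hmono.mul_sub_le_integral h0 ht.le hs
  have h2 := hmono.mul_sub_le_integral h0 ht.le (by positivity : 0 ≤ 2 * t)
  rw [← hΦ] at h1 h2
  linarith
end

section
/- Assume (φ₁), (φ₃) with constants 1 < ℓ ≤ m < ∞, that φ is continuously differentiable on (0,∞), and that φ is nondecreasing on (0,∞). Define a(t) = t·φ(|t|) for t ≠ 0 and a(0) = 0. Then for all ξ, η ∈ ℝ one has (a(ξ) − a(η))·(ξ − η) ≥ 4^{1−m}·ℓ·Φ(|ξ − η|). -/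
/-- If `t * g t ≤ m * f t` for the derivative `g` of `f` on `(0,∞)`, then `f` grows at most
like the power `m`; in particular it satisfies a doubling inequality. -/
theorem doubling_of_mul_deriv_le {f g : ℝ → ℝ} {m : ℝ}
    (hf : ∀ t > (0:ℝ), HasDerivAt f (g t) t) (hg : ∀ t > (0:ℝ), t * g t ≤ m * f t)
    {s : ℝ} (hs : 0 < s) : f (2 * s) ≤ (2:ℝ) ^ m * f s := by
  have hd : ∀ t > (0:ℝ), HasDerivAt (fun t => f t * t ^ (-m))
      (g t * t ^ (-m) + f t * (-m * t ^ (-m - 1))) t := fun t ht =>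
    (hf t ht).mul (Real.hasDerivAt_rpow_const (Or.inl ht.ne'))
  have hanti : AntitoneOn (fun t => f t * t ^ (-m)) (Set.Ioi 0) := by
    refine antitoneOn_of_deriv_nonpos (convex_Ioi 0)
      (fun t ht => (hd t ht).continuousAt.continuousWithinAt)
      (fun t ht => ?_) (fun t ht => ?_)
    · rw [interior_Ioi] at ht
      exact (hd t ht).differentiableAt.differentiableWithinAt
    · rw [interior_Ioi] at ht
      have ht0 : 0 < t := ht
      rw [(hd t ht).deriv]
      have e : t ^ (-m) = t ^ (-m - 1) * t := by
        rw [Real.rpow_sub_one ht0.ne']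
        field_simp
      have hp : 0 < t ^ (-m - 1) := Real.rpow_pos_of_pos ht0 _
      rw [e]
      nlinarith [mul_le_mul_of_nonneg_left (hg t ht0) hp.le]
  have h2s : 0 < 2 * s := by positivity
  have h : f (2 * s) * (2 * s) ^ (-m) ≤ f s * s ^ (-m) :=
    hanti (Set.mem_Ioi.2 hs) (Set.mem_Ioi.2 h2s) (by linarith)
  rw [Real.mul_rpow (by norm_num) hs.le, Real.rpow_neg (by norm_num : (0:ℝ) ≤ 2),
    ← mul_assoc] at h
  have h' := le_of_mul_le_mul_right h (Real.rpow_pos_of_pos hs _)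
  have h2 : (0:ℝ) < 2 ^ m := by positivity
  rw [← div_eq_mul_inv, div_le_iff₀ h2] at h'
  linarith


/-- Under (φ₁), (φ₃), with `φ` continuously differentiable and nondecreasing on `(0,∞)`,
the nonlinearity `a(t) = t·φ(|t|)` satisfies the uniform monotonicity estimate
`(a(ξ) − a(η))·(ξ − η) ≥ 4^{1−m}·ℓ·Φ(|ξ − η|)`. -/
theorem stmt6 (φ Φ : ℝ → ℝ) (a : ℝ → ℝ) (ℓ m : ℝ)
    (hφc : ContinuousOn φ (Set.Ioi 0))
    (hφ0 : ∀ t > (0:ℝ), 0 ≤ φ t)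
    (hΦ : ∀ t, Φ t = ∫ τ in (0:ℝ)..t, τ * φ τ)
    (hφ1a : Filter.Tendsto (fun τ => τ * φ τ) (nhdsWithin 0 (Set.Ioi 0)) (nhds 0))
    (hφ1b : Filter.Tendsto (fun τ => τ * φ τ) Filter.atTop Filter.atTop)
    (hℓ : 1 < ℓ) (hℓm : ℓ ≤ m)
    (hφ3 : ∀ t > (0:ℝ), 0 < Φ t ∧ ℓ * Φ t ≤ t ^ 2 * φ t ∧ t ^ 2 * φ t ≤ m * Φ t)
    (hφ4 : ContDiffOn ℝ 1 φ (Set.Ioi 0))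
    (hφ5 : MonotoneOn φ (Set.Ioi 0))
    (ha : ∀ t : ℝ, t ≠ 0 → a t = t * φ |t|)
    (ha0 : a 0 = 0) :
    ∀ ξ η : ℝ, (4:ℝ) ^ (1 - m) * ℓ * Φ |ξ - η| ≤ (a ξ - a η) * (ξ - η) := by
  have hΦd : ∀ t > (0:ℝ), HasDerivAt Φ (t * φ t) t := by
    intro t ht
    have hc : ContinuousOn (fun τ => τ * φ τ) (Set.Ioi 0) := continuousOn_id.mul hφc
    have hint : IntervalIntegrable (fun τ => τ * φ τ) MeasureTheory.volume 0 t := by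
      by_contra hn
      have := (hφ3 t ht).1
      rw [hΦ, intervalIntegral.integral_undef hn] at this
      exact lt_irrefl _ this
    rw [funext hΦ]
    exact intervalIntegral.integral_hasDerivAt_right hint
      (hc.stronglyMeasurableAtFilter isOpen_Ioi t ht) (hc.continuousAt (Ioi_mem_nhds ht))
  have hdbl : ∀ s > (0:ℝ), Φ (2 * s) ≤ (2:ℝ) ^ m * Φ s := fun s hs =>
    doubling_of_mul_deriv_le hΦd (fun t ht => by nlinarith [(hφ3 t ht).2.2]) hs
  have ha' : ∀ t, a t = t * φ |t| := by
    intro t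
    rcases eq_or_ne t 0 with rfl | h
    · simp [ha0]
    · exact ha t h
  have hodd : ∀ t, a (-t) = -a t := fun t => by simp [ha']
  have h4le : (4:ℝ) ^ (1 - m) ≤ 1 :=
    Real.rpow_le_one_of_one_le_of_nonpos (by norm_num) (by linarith)
  have h4dbl : (4:ℝ) ^ (1 - m) * (2:ℝ) ^ m ≤ 2 := by
    have e : (4:ℝ) = 2 ^ (2:ℝ) := by norm_num
    rw [e, ← Real.rpow_mul (by norm_num), ← Real.rpow_add (by norm_num)]
    calc (2:ℝ) ^ (2 * (1 - m) + m) ≤ 2 ^ (1:ℝ) :=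
          Real.rpow_le_rpow_of_exponent_le (by norm_num) (by linarith)
      _ = 2 := by norm_num
  have h4pos : (0:ℝ) < 4 ^ (1 - m) := by positivity
  have hsame : ∀ x y : ℝ, 0 ≤ y → y < x →
      (4:ℝ) ^ (1 - m) * ℓ * Φ (x - y) ≤ (a x - a y) * (x - y) := by
    intro x y hy hxy
    have hx : 0 < x := by linarith
    have hd : 0 < x - y := by linarith
    obtain ⟨hpos, hlow, -⟩ := hφ3 _ hd
    rw [ha' x, ha' y, abs_of_pos hx, abs_of_nonneg hy]
    have hyφ : y * φ y ≤ y * φ x := by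
      rcases hy.eq_or_lt with rfl | hy
      · simp
      · exact mul_le_mul_of_nonneg_left (hφ5 hy hx hxy.le) hy.le
    have hdφ : φ (x - y) ≤ φ x := hφ5 hd hx (by linarith)
    calc (4:ℝ) ^ (1 - m) * ℓ * Φ (x - y) = 4 ^ (1 - m) * (ℓ * Φ (x - y)) := by ring
      _ ≤ 1 * (ℓ * Φ (x - y)) := by gcongr
      _ ≤ (x - y) ^ 2 * φ (x - y) := by linarith
      _ ≤ (x - y) ^ 2 * φ x := by gcongr
      _ = (x * φ x - y * φ x) * (x - y) := by ring
      _ ≤ (x * φ x - y * φ y) * (x - y) := by gcongr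
  have hopp : ∀ x y : ℝ, 0 < x → 0 < y →
      (4:ℝ) ^ (1 - m) * ℓ * Φ (x + y) ≤ (x * φ x + y * φ y) * (x + y) := by
    intro x y hx hy
    obtain ⟨s, hs⟩ : ∃ s, x + y = 2 * s := ⟨(x + y) / 2, by ring⟩
    have hs0 : 0 < s := by linarith
    have hge : ∀ z, s ≤ z → s * φ s ≤ z * φ z := fun z hz =>
      mul_le_mul hz (hφ5 hs0 (hs0.trans_le hz) hz) (hφ0 s hs0) (hs0.le.trans hz)
    have hx' := mul_nonneg hx.le (hφ0 x hx)
    have hy' := mul_nonneg hy.le (hφ0 y hy)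
    have hsum : s * φ s ≤ x * φ x + y * φ y := by
      rcases le_total s x with h | h
      · linarith [hge x h]
      · linarith [hge y (by linarith)]
    obtain ⟨hpos, hlow, -⟩ := hφ3 s hs0
    rw [hs]
    calc (4:ℝ) ^ (1 - m) * ℓ * Φ (2 * s) ≤ 4 ^ (1 - m) * ℓ * (2 ^ m * Φ s) := by
          gcongr
          exact hdbl s hs0
      _ = (4 ^ (1 - m) * 2 ^ m) * (ℓ * Φ s) := by ring
      _ ≤ 2 * (ℓ * Φ s) := by gcongr
      _ ≤ 2 * (s ^ 2 * φ s) := by gcongr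
      _ = (s * φ s) * (2 * s) := by ring
      _ ≤ (x * φ x + y * φ y) * (2 * s) := by gcongr
  have hlt : ∀ x y : ℝ, y < x →
      (4:ℝ) ^ (1 - m) * ℓ * Φ (x - y) ≤ (a x - a y) * (x - y) := by
    intro x y hxy
    rcases le_or_gt 0 y with hy | hy
    · exact hsame x y hy hxy
    rcases le_or_gt x 0 with hx | hx
    · have h := hsame (-y) (-x) (by linarith) (by linarith)
      rw [hodd, hodd] at h
      convert h using 1 <;> ring_nf
    · have h := hopp x (-y) hx (by linarith)
      rw [ha' x, ha' y, abs_of_pos hx, abs_of_neg hy]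
      convert h using 1 <;> ring_nf
  intro ξ η
  rcases lt_trichotomy ξ η with h | rfl | h
  · rw [abs_sub_comm, abs_of_pos (sub_pos.2 h)]
    linarith [hlt η ξ h]
  · simp [hΦ 0]
  · rw [abs_of_pos (sub_pos.2 h)]
    exact hlt ξ η h
end

section
/- Assume (φ₁), (φ₂) and (φ₃) with constants 1 < ℓ ≤ m < ∞, and define a(t) = t·φ(|t|) for t ≠ 0 and a(0) = 0. Then there exists a constant C > 0 such that for all a, b ∈ ℝ: Φ(|a|) ≤ ℓ^{−1}·φ(|a|)·a² ≤ C·[ (a(a) − a(b))·(a − b) + Φ(|b|) ], where φ(|a|)·a² is interpreted as 0 when a = 0. -/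
/-- Bounds for the increment of the primitive of a function monotone on `[0, ∞)`. -/
theorem MonotoneOn.integral_increment_bounds {g : ℝ → ℝ} (hg : MonotoneOn g (Set.Ici 0))
    {t s : ℝ} (ht : 0 ≤ t) (hts : t ≤ s) :
    g t * (s - t) ≤ (∫ τ in (0:ℝ)..s, g τ) - ∫ τ in (0:ℝ)..t, g τ ∧
      (∫ τ in (0:ℝ)..s, g τ) - ∫ τ in (0:ℝ)..t, g τ ≤ g s * (s - t) := by
  have hint : ∀ u v : ℝ, 0 ≤ u → 0 ≤ v → IntervalIntegrable g MeasureTheory.volume u v := by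
    intro u v hu hv
    refine (hg.mono fun z hz => ?_).intervalIntegrable
    exact le_trans (le_min hu hv) hz.1
  rw [intervalIntegral.integral_interval_sub_left (hint 0 s le_rfl (ht.trans hts))
    (hint 0 t le_rfl ht)]
  have hconst : ∀ c : ℝ, ∫ _ in t..s, c = c * (s - t) := fun c => by
    rw [intervalIntegral.integral_const, smul_eq_mul, mul_comm]
  rw [← hconst (g t), ← hconst (g s)]
  constructor
  · refine intervalIntegral.integral_mono_on hts intervalIntegrable_const
      (hint t s ht (ht.trans hts)) fun z hz => ?_
    exact hg ht (ht.trans hz.1) hz.1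
  · refine intervalIntegral.integral_mono_on hts (hint t s ht (ht.trans hts))
      intervalIntegrable_const fun z hz => ?_
    exact hg (ht.trans hz.1) (ht.trans hts) hz.2

/-- If `G` has increments bounded by `g s * (s - t)` and `s * g s ≤ m * G s`, then `G` satisfies
a `Δ₂`-type growth condition for every dilation factor `k`. -/
theorem exists_growth_const {g G : ℝ → ℝ} {m : ℝ} (hm : 0 < m)
    (hG : ∀ t > 0, 0 ≤ G t) (hgG : ∀ t > 0, t * g t ≤ m * G t)
    (hinc : ∀ t s, 0 ≤ t → t ≤ s → G s - G t ≤ g s * (s - t)) (k : ℝ) :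
    ∃ n : ℕ, ∃ q : ℝ, k ≤ q ∧ 0 < q ∧ ∀ t > 0, G (q * t) ≤ 2 ^ n * G t := by
  set p : ℝ := 1 + 1 / (2 * m) with hp
  have hp1 : 1 < p := by
    have : 0 < 1 / (2 * m) := by positivity
    linarith
  have hp0 : 0 < p := by linarith
  have hmp : 2 * m * (p - 1) = 1 := by rw [hp]; field_simp; ring
  have hstep : ∀ t > 0, G (p * t) ≤ 2 * G t := by
    intro t ht
    have hpt : 0 < p * t := mul_pos hp0 ht
    have h1 := hinc t (p * t) ht.le (by nlinarith)
    have h2 := hgG _ hpt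
    have h3 := hG _ hpt
    have h4 : p * (2 * (g (p * t) * (p * t - t))) ≤ G (p * t) := by
      have := mul_le_mul_of_nonneg_left h2 (by linarith : 0 ≤ 2 * (p - 1))
      calc _ = 2 * (p - 1) * (p * t * g (p * t)) := by ring
        _ ≤ 2 * (p - 1) * (m * G (p * t)) := this
        _ = (2 * m * (p - 1)) * G (p * t) := by ring
        _ = _ := by rw [hmp, one_mul]
    have h5 : 2 * (g (p * t) * (p * t - t)) ≤ G (p * t) := by
      by_contra! h
      nlinarith
    linarith
  obtain ⟨n, hn⟩ := pow_unbounded_of_one_lt k hp1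
  refine ⟨n, p ^ n, hn.le, by positivity, fun t ht => ?_⟩
  clear hn
  induction n with
  | zero => simp
  | succ n ih =>
    have := hstep (p ^ n * t) (by positivity)
    calc G (p ^ (n + 1) * t) = G (p * (p ^ n * t)) := by ring_nf
      _ ≤ 2 * G (p ^ n * t) := this
      _ ≤ 2 * (2 ^ n * G t) := by linarith
      _ = _ := by ring


/-- Under (φ₁)–(φ₃) there is a constant `C > 0` such that for all `x, y ∈ ℝ`,
`Φ(|x|) ≤ ℓ⁻¹·φ(|x|)·x² ≤ C·[(a(x) − a(y))·(x − y) + Φ(|y|)]`,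
where `a(t) = t·φ(|t|)` (`a(0) = 0`), so `φ(|x|)·x² = a(x)·x` is `0` at `x = 0`. -/
theorem stmt7 (φ Φ : ℝ → ℝ) (a : ℝ → ℝ) (ℓ m : ℝ)
    (hφc : ContinuousOn φ (Set.Ioi 0))
    (hφ0 : ∀ t > (0:ℝ), 0 ≤ φ t)
    (hΦ : ∀ t, Φ t = ∫ τ in (0:ℝ)..t, τ * φ τ)
    (hφ1a : Filter.Tendsto (fun τ => τ * φ τ) (nhdsWithin 0 (Set.Ioi 0)) (nhds 0))
    (hφ1b : Filter.Tendsto (fun τ => τ * φ τ) Filter.atTop Filter.atTop)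
    (hφ2 : MonotoneOn (fun τ => τ * φ τ) (Set.Ioi 0))
    (hℓ : 1 < ℓ) (hℓm : ℓ ≤ m)
    (hφ3 : ∀ t > (0:ℝ), 0 < Φ t ∧ ℓ * Φ t ≤ t ^ 2 * φ t ∧ t ^ 2 * φ t ≤ m * Φ t)
    (ha : ∀ t : ℝ, t ≠ 0 → a t = t * φ |t|)
    (ha0 : a 0 = 0) :
    ∃ C > (0:ℝ), ∀ x y : ℝ,
      Φ |x| ≤ ℓ⁻¹ * (a x * x) ∧
      ℓ⁻¹ * (a x * x) ≤ C * ((a x - a y) * (x - y) + Φ |y|) := by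
  have hm : 0 < m := by linarith
  have hℓ1 : 0 < ℓ - 1 := by linarith
  have hℓ0 : 0 < ℓ := by linarith
  set g : ℝ → ℝ := fun τ => τ * φ τ with hg
  have hg0 : g 0 = 0 := by simp [hg]
  have hgnn : ∀ t, 0 ≤ t → 0 ≤ g t := by
    intro t ht
    rcases ht.eq_or_lt with rfl | ht
    · exact hg0.ge
    · exact mul_nonneg ht.le (hφ0 t ht)
  have hmono : MonotoneOn g (Set.Ici 0) := by
    intro u hu v hv huv
    rcases (Set.mem_Ici.mp hu).eq_or_lt with rfl | hu
    · rw [hg0]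
      exact hgnn v hv
    · exact hφ2 hu (hu.trans_le huv) huv
  have hΦ0 : Φ 0 = 0 := by simp [hΦ]
  have hΦnn : ∀ t, 0 ≤ t → 0 ≤ Φ t := by
    intro t ht
    rcases ht.eq_or_lt with rfl | ht
    · exact hΦ0.ge
    · exact (hφ3 t ht).1.le
  have hinc : ∀ t s, 0 ≤ t → t ≤ s →
      g t * (s - t) ≤ Φ s - Φ t ∧ Φ s - Φ t ≤ g s * (s - t) := by
    intro t s ht hts
    rw [hΦ, hΦ]
    exact hmono.integral_increment_bounds ht hts
  have hlow : ∀ t, 0 ≤ t → ℓ * Φ t ≤ t * g t := by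
    intro t ht
    rcases ht.eq_or_lt with rfl | ht
    · simp [hΦ0]
    · exact (hφ3 t ht).2.1.trans_eq (by simp only [hg]; ring)
  have hup : ∀ t, 0 ≤ t → t * g t ≤ m * Φ t := by
    intro t ht
    rcases ht.eq_or_lt with rfl | ht
    · simp [hΦ0]
    · exact le_trans (by simp only [hg]; exact le_of_eq (by ring)) (hφ3 t ht).2.2
  have haeq : ∀ t, a t = t * φ |t| := by
    intro t
    by_cases ht : t = 0
    · simp [ht, ha0]
    · exact ha t ht
  have haa : ∀ t, a t * t = |t| * g |t| := by
    intro t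
    simp only [haeq, hg]
    rw [← mul_assoc, abs_mul_abs_self]
    ring
  have hcross : ∀ u v, a u * v ≤ g |u| * |v| := by
    intro u v
    by_cases hu : u = 0
    · simp [hu, ha0, hg0]
    · have h1 := hφ0 _ (abs_pos.mpr hu)
      have h2 := mul_le_mul_of_nonneg_right ((le_abs_self (u * v)).trans_eq (abs_mul u v)) h1
      simp only [haeq, hg]
      linarith
  obtain ⟨n, q, hkq, hq, hgrow⟩ := exists_growth_const (g := g) (G := Φ) hm
    (fun t ht => hΦnn t ht.le) (fun t ht => hup t ht.le)
    (fun t s ht hts => (hinc t s ht hts).2) (max 1 (2 * m / (ℓ - 1)))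
  have hq1 : 1 ≤ q := (le_max_left _ _).trans hkq
  have hqk : 2 * m ≤ q * (ℓ - 1) := (div_le_iff₀ hℓ1).mp ((le_max_right _ _).trans hkq)
  have key : ∀ s t, 0 ≤ s → 0 ≤ t →
      Φ s ≤ (2 / (ℓ - 1) + 2 ^ n) * ((g s - g t) * (s - t) + Φ t) := by
    intro s t hs ht
    have hD : 0 ≤ (g s - g t) * (s - t) := by
      rcases le_total s t with h | h
      · nlinarith [hmono hs ht h]
      · nlinarith [hmono ht hs h]
    have hc : 0 < 2 / (ℓ - 1) := by positivity
    have hK : (0:ℝ) < 2 ^ n := by positivity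
    have hΦt := hΦnn t ht
    rw [add_mul]
    rcases le_or_gt (q * t) s with h | h
    · have hts : t ≤ s := by nlinarith
      have h1 := (hinc t s ht hts).1
      have h2 := hlow s hs
      have h3 := hup s hs
      have h4 : 2 * (g s * t) ≤ (ℓ - 1) * Φ s := by
        have e1 : 2 * m * t ≤ (ℓ - 1) * s := by nlinarith
        have e2 := mul_le_mul_of_nonneg_right e1 (hgnn s hs)
        have e3 := mul_le_mul_of_nonneg_left h3 hℓ1.le
        refine le_of_mul_le_mul_left ?_ hm
        linarith
      have h5 : (ℓ - 1) * Φ s ≤ 2 * ((g s - g t) * (s - t) + Φ t) := by nlinarith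
      have h6 : Φ s ≤ 2 / (ℓ - 1) * ((g s - g t) * (s - t) + Φ t) := by
        rw [div_mul_eq_mul_div, le_div_iff₀ hℓ1]
        linarith
      have : 0 ≤ 2 ^ n * ((g s - g t) * (s - t) + Φ t) := by positivity
      linarith
    · have ht0 : 0 < t := by
        by_contra! h0
        nlinarith
      have h1 := hinc s (q * t) hs h.le
      have h2 := mul_nonneg (hgnn s hs) (sub_nonneg.mpr h.le)
      have h3 := hgrow t ht0
      have h4 : 0 ≤ 2 / (ℓ - 1) * ((g s - g t) * (s - t) + Φ t) := by positivity
      have h5 : 0 ≤ 2 ^ n * ((g s - g t) * (s - t)) := by positivity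
      linarith [h1.1]
  refine ⟨ℓ⁻¹ * (m * (2 / (ℓ - 1) + 2 ^ n)), by positivity, fun x y => ?_⟩
  have hx := abs_nonneg x
  have hy := abs_nonneg y
  rw [haa x]
  constructor
  · rw [inv_mul_eq_div, le_div_iff₀ hℓ0]
    linarith [hlow _ hx]
  · have hred : (g |x| - g |y|) * (|x| - |y|) ≤ (a x - a y) * (x - y) := by
      linarith [haa x, haa y, hcross x y, hcross y x]
    rw [mul_assoc]
    refine mul_le_mul_of_nonneg_left ?_ (by positivity)
    refine (hup _ hx).trans ?_
    rw [mul_assoc]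
    refine mul_le_mul_of_nonneg_left ((key _ _ hx hy).trans ?_) hm.le
    gcongr
end

section
/- Assume (φ₁), (φ₂) and (φ₃) with constants 1 < ℓ ≤ m < ∞. Then for every ε ∈ (0,1) there exists a constant C_ε > 0 such that for all A, B ∈ ℝ: |Φ(|A|) − Φ(|A − B|)| ≤ ε·2^{2m−1}·Φ(|A − B|) + C_ε·Φ(|B|). -/
open Set intervalIntegral in
/-- The integral of a function that is monotone on `[0, ∞)` grows at most like the length of the
interval times the value at the right endpoint. -/
theorem integral_sub_le_of_monotoneOn {g : ℝ → ℝ} (hg : MonotoneOn g (Ici 0)) {s t : ℝ}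
    (ht : 0 ≤ t) (hts : t ≤ s) :
    (∫ τ in (0:ℝ)..s, g τ) - (∫ τ in (0:ℝ)..t, g τ) ≤ (s - t) * g s := by
  have hint : ∀ a b : ℝ, 0 ≤ a → 0 ≤ b → IntervalIntegrable g MeasureTheory.volume a b :=
    fun a b ha hb => (hg.mono fun x hx => (le_min ha hb).trans hx.1).intervalIntegrable
  rw [integral_interval_sub_left (hint 0 s le_rfl (ht.trans hts)) (hint 0 t le_rfl ht)]
  calc ∫ τ in t..s, g τ ≤ ∫ _ in t..s, g s :=
        integral_mono_on hts (hint t s ht (ht.trans hts)) intervalIntegrable_const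
          fun x hx => hg (ht.trans hx.1) (ht.trans hts) hx.2
    _ = (s - t) * g s := by simp

/-- Iterated doubling: if `Φ s ≤ 2 Φ t` whenever `s` exceeds `t` by a factor at most `r > 1`, then
`Φ` grows by at most a constant factor when its argument does. -/
theorem exists_dilation_bound {Φ : ℝ → ℝ} (hmono : MonotoneOn Φ (Set.Ici 0)) {r : ℝ} (hr : 1 < r)
    (hdouble : ∀ t, 0 ≤ t → Φ (r * t) ≤ 2 * Φ t) (c : ℝ) :
    ∃ K > (0:ℝ), ∀ t s, 0 ≤ t → 0 ≤ s → s ≤ c * t → Φ s ≤ K * Φ t := by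
  have hr0 : 0 < r := by linarith
  have hpow : ∀ (n : ℕ) (t : ℝ), 0 ≤ t → Φ (r ^ n * t) ≤ 2 ^ n * Φ t := by
    intro n
    induction n with
    | zero => simp
    | succ n ih =>
      intro t ht
      calc Φ (r ^ (n + 1) * t) = Φ (r * (r ^ n * t)) := by ring_nf
        _ ≤ 2 * Φ (r ^ n * t) := hdouble _ (by positivity)
        _ ≤ 2 * (2 ^ n * Φ t) := by linarith [ih t ht]
        _ = 2 ^ (n + 1) * Φ t := by ring
  obtain ⟨n, hn⟩ := pow_unbounded_of_one_lt c hr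
  refine ⟨2 ^ n, by positivity, fun t s ht hs hst => ?_⟩
  have hsn : s ≤ r ^ n * t := hst.trans (mul_le_mul_of_nonneg_right hn.le ht)
  exact (hmono hs (hs.trans hsn) hsn).trans (hpow n t ht)

/-- If `Φ` is nondecreasing and satisfies `Φ s - Φ t ≤ m (1 - t / s) Φ s` for `t ≤ s`, then
`Φ (p + q) - Φ p` is bounded by a small multiple of `Φ p` plus a large multiple of `Φ q`. -/
theorem exists_add_sub_le {Φ : ℝ → ℝ} (hmono : MonotoneOn Φ (Set.Ici 0))
    (hpos : ∀ t, 0 ≤ t → 0 ≤ Φ t) {m : ℝ} (hm : 1 < m)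
    (hinc : ∀ t s, 0 ≤ t → t ≤ s → s * (Φ s - Φ t) ≤ (s - t) * (m * Φ s)) {δ : ℝ} (hδ : 0 < δ) :
    ∃ C > (0:ℝ), ∀ p q, 0 ≤ p → 0 ≤ q → Φ (p + q) - Φ p ≤ δ * Φ p + C * Φ q := by
  have hm1 : 0 < 2 * m - 1 := by linarith
  have hr : 1 < 2 * m / (2 * m - 1) := by rw [lt_div_iff₀ hm1]; linarith
  have hdouble : ∀ t, 0 ≤ t → Φ (2 * m / (2 * m - 1) * t) ≤ 2 * Φ t := by
    intro t ht
    rcases ht.eq_or_lt with rfl | ht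
    · have := hpos 0 le_rfl
      rw [mul_zero]
      linarith
    · set s := 2 * m / (2 * m - 1) * t with hs
      have hst : t ≤ s := le_mul_of_one_le_left ht.le hr.le
      have hs' : (2 * m) * (s - t) = s := by
        rw [hs]
        field_simp
        ring
      have h := hinc t s ht.le hst
      have h2 : s * (Φ s - Φ t) ≤ s * (Φ s / 2) := by
        calc s * (Φ s - Φ t) ≤ (s - t) * (m * Φ s) := h
          _ = ((2 * m) * (s - t)) * (Φ s / 2) := by ring
          _ = s * (Φ s / 2) := by rw [hs']
      linarith [le_of_mul_le_mul_left h2 (ht.trans_le hst)]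
  obtain ⟨K, hK, hKb⟩ := exists_dilation_bound hmono hr hdouble (m * (1 + δ) / δ)
  refine ⟨K, hK, fun p q hp hq => ?_⟩
  have hΦp := hpos p hp
  have hΦq := hpos q hq
  have hΦpq := hpos (p + q) (by positivity)
  rcases le_or_gt (p + q) (m * (1 + δ) / δ * q) with hlarge | hsmall
  · have := hKb q (p + q) hq (by positivity) hlarge
    have := mul_nonneg hδ.le hΦp
    linarith
  · have hpq : 0 < p + q := lt_of_le_of_lt (by positivity) hsmall
    have hsmall' : (1 + δ) * (m * q) ≤ δ * (p + q) := by
      rw [div_mul_eq_mul_div, div_lt_iff₀ hδ] at hsmall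
      linarith
    have h := hinc p (p + q) hp (by linarith)
    have h2 : (p + q) * ((1 + δ) * (Φ (p + q) - Φ p)) ≤ (p + q) * (δ * Φ (p + q)) := by
      calc (p + q) * ((1 + δ) * (Φ (p + q) - Φ p))
          = (1 + δ) * ((p + q) * (Φ (p + q) - Φ p)) := by ring
        _ ≤ (1 + δ) * ((p + q - p) * (m * Φ (p + q))) := by gcongr
        _ = (1 + δ) * (m * q) * Φ (p + q) := by ring
        _ ≤ δ * (p + q) * Φ (p + q) := by gcongr
        _ = (p + q) * (δ * Φ (p + q)) := by ring
    have := le_of_mul_le_mul_left h2 hpq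
    have := mul_nonneg hK.le hΦq
    linarith


/-- Under (φ₁)–(φ₃): for every `ε ∈ (0,1)` there is `C_ε > 0` such that for all `A, B`,
`|Φ(|A|) − Φ(|A − B|)| ≤ ε·2^{2m−1}·Φ(|A − B|) + C_ε·Φ(|B|)`. -/
theorem stmt8 (φ Φ : ℝ → ℝ) (ℓ m : ℝ)
    (hφc : ContinuousOn φ (Set.Ioi 0))
    (hφ0 : ∀ t > (0:ℝ), 0 ≤ φ t)
    (hΦ : ∀ t, Φ t = ∫ τ in (0:ℝ)..t, τ * φ τ)
    (hφ1a : Filter.Tendsto (fun τ => τ * φ τ) (nhdsWithin 0 (Set.Ioi 0)) (nhds 0))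
    (hφ1b : Filter.Tendsto (fun τ => τ * φ τ) Filter.atTop Filter.atTop)
    (hφ2 : MonotoneOn (fun τ => τ * φ τ) (Set.Ioi 0))
    (hℓ : 1 < ℓ) (hℓm : ℓ ≤ m)
    (hφ3 : ∀ t > (0:ℝ), 0 < Φ t ∧ ℓ * Φ t ≤ t ^ 2 * φ t ∧ t ^ 2 * φ t ≤ m * Φ t) :
    ∀ ε : ℝ, ε ∈ Set.Ioo (0:ℝ) 1 → ∃ C > (0:ℝ), ∀ A B : ℝ,
      abs (Φ |A| - Φ |A - B|) ≤ ε * (2:ℝ) ^ (2 * m - 1) * Φ |A - B| + C * Φ |B| := by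
  rintro ε ⟨hε, -⟩
  have hg : MonotoneOn (fun τ => τ * φ τ) (Set.Ici 0) := by
    intro a ha b hb hab
    rcases (Set.mem_Ici.1 ha).eq_or_lt with rfl | ha
    · rcases hab.eq_or_lt with rfl | hb
      · exact le_rfl
      · simpa using mul_nonneg hb.le (hφ0 b hb)
    · exact hφ2 ha (ha.trans_le hab) hab
  have hΦ0 : Φ 0 = 0 := by simp [hΦ]
  have hpos : ∀ t, 0 ≤ t → 0 ≤ Φ t := by
    intro t ht
    rcases ht.eq_or_lt with rfl | ht
    · exact hΦ0.ge
    · exact (hφ3 t ht).1.le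
  have hinc : ∀ t s, 0 ≤ t → t ≤ s → s * (Φ s - Φ t) ≤ (s - t) * (m * Φ s) := by
    intro t s ht hts
    rcases (ht.trans hts).eq_or_lt with rfl | hs
    · simp [hΦ0]
    · have h := integral_sub_le_of_monotoneOn hg ht hts
      rw [← hΦ, ← hΦ] at h
      calc s * (Φ s - Φ t) ≤ s * ((s - t) * (s * φ s)) := by gcongr
        _ = (s - t) * (s ^ 2 * φ s) := by ring
        _ ≤ (s - t) * (m * Φ s) :=
          mul_le_mul_of_nonneg_left (hφ3 s hs).2.2 (sub_nonneg.2 hts)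
  have hmono : MonotoneOn Φ (Set.Ici 0) := by
    intro a ha b hb hab
    rw [hΦ, hΦ]
    refine intervalIntegral.integral_mono_interval le_rfl ha hab ?_
      (hg.mono fun x hx => (le_min le_rfl hb).trans hx.1).intervalIntegrable
    filter_upwards [MeasureTheory.ae_restrict_mem measurableSet_Ioc] with x hx
    exact mul_nonneg hx.1.le (hφ0 x hx.1)
  obtain ⟨C, hC, hCb⟩ := exists_add_sub_le hmono hpos (hℓ.trans_le hℓm) hinc
    (δ := ε * (2:ℝ) ^ (2 * m - 1)) (by positivity)
  refine ⟨C, hC, fun A B => ?_⟩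
  have hδ : 0 < ε * (2:ℝ) ^ (2 * m - 1) := by positivity
  have hupper : Φ |A| ≤ Φ (|A - B| + |B|) :=
    hmono (abs_nonneg A) (by simp only [Set.mem_Ici]; positivity)
      (by simpa using abs_add_le (A - B) B)
  have hlower : Φ |A - B| ≤ Φ (|A| + |B|) :=
    hmono (abs_nonneg (A - B)) (by simp only [Set.mem_Ici]; positivity) (abs_sub A B)
  have h1 := hCb |A - B| |B| (abs_nonneg _) (abs_nonneg _)
  have h2 := hCb |A| |B| (abs_nonneg _) (abs_nonneg _)
  rw [abs_le]
  refine ⟨?_, by linarith⟩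
  rcases le_total (Φ |A|) (Φ |A - B|) with h | h
  · have := mul_le_mul_of_nonneg_left h hδ.le
    linarith
  · have := mul_nonneg hδ.le (hpos _ (abs_nonneg (A - B)))
    have := mul_nonneg hC.le (hpos _ (abs_nonneg B))
    linarith
end

section
/- Let ℓ ≥ 1 and suppose that ℓ·Φ(t) ≤ t²·φ(t) for all t > 0, where φ : (0,∞) → [0,∞) is continuous and Φ(t) = ∫₀^t τ·φ(τ) dτ. Then the function t ↦ Φ(t)/t^ℓ is nondecreasing on (0,∞). -/
open MeasureTheory in
/-- A function continuous on `(0,∞)` and integrable near `0` has a differentiable primitive. -/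
lemma hasDerivAt_integral_of_continuousOn_Ioi {f : ℝ → ℝ} (hf : ContinuousOn f (Set.Ioi 0))
    {a t : ℝ} (ha : 0 < a) (hint : IntervalIntegrable f volume 0 a) (ht : 0 < t) :
    HasDerivAt (fun u => ∫ τ in (0:ℝ)..u, f τ) (f t) t := by
  have hat : IntervalIntegrable f volume a t :=
    (hf.mono fun x hx => (lt_min ha ht).trans_le hx.1).intervalIntegrable
  exact intervalIntegral.integral_hasDerivAt_right (hint.trans hat)
    (hf.stronglyMeasurableAtFilter isOpen_Ioi t ht) (hf.continuousAt (Ioi_mem_nhds ht))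

/-- If `ℓ * F t ≤ t * F' t` on `(0,∞)`, then `F t / t ^ ℓ` is nondecreasing there. -/
lemma monotoneOn_div_rpow_of_mul_le_mul_deriv {F F' : ℝ → ℝ} {ℓ : ℝ}
    (hF : ∀ t > 0, HasDerivAt F (F' t) t) (h : ∀ t > 0, ℓ * F t ≤ t * F' t) :
    MonotoneOn (fun t => F t / t ^ ℓ) (Set.Ioi 0) := by
  have hderiv (t : ℝ) (ht : 0 < t) := (hF t ht).div
    (Real.hasDerivAt_rpow_const (p := ℓ) (Or.inl ht.ne')) (Real.rpow_pos_of_pos ht ℓ).ne'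
  refine monotoneOn_of_deriv_nonneg (convex_Ioi 0)
    (fun t ht => (hderiv t ht).continuousAt.continuousWithinAt)
    (fun t ht => ?_) (fun t ht => ?_) <;> rw [interior_Ioi] at ht
  · exact (hderiv t ht).differentiableAt.differentiableWithinAt
  · have ht : 0 < t := ht
    refine (hderiv t ht).deriv.symm ▸ div_nonneg ?_ (sq_nonneg _)
    have hnum : F' t * t ^ ℓ - F t * (ℓ * t ^ (ℓ - 1)) = (t * F' t - ℓ * F t) * t ^ (ℓ - 1) := by
      rw [Real.rpow_sub_one ht.ne']
      field_simp
    rw [hnum]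
    exact mul_nonneg (sub_nonneg.2 (h t ht)) (Real.rpow_nonneg ht.le _)

/-- If `ℓ ≥ 1` and `ℓ·Φ(t) ≤ t²·φ(t)` for all `t > 0`, then `t ↦ Φ(t)/t^ℓ`
is nondecreasing on `(0,∞)`. -/
theorem stmt9 (φ Φ : ℝ → ℝ) (ℓ : ℝ)
    (hφc : ContinuousOn φ (Set.Ioi 0))
    (hφ0 : ∀ t > (0:ℝ), 0 ≤ φ t)
    (hΦ : ∀ t, Φ t = ∫ τ in (0:ℝ)..t, τ * φ τ)
    (hℓ : 1 ≤ ℓ)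
    (hφ3 : ∀ t > (0:ℝ), ℓ * Φ t ≤ t ^ 2 * φ t) :
    MonotoneOn (fun t => Φ t / t ^ ℓ) (Set.Ioi 0) := by
  by_cases hint : ∃ a > 0, IntervalIntegrable (fun τ => τ * φ τ) MeasureTheory.volume 0 a
  · obtain ⟨a, ha, hint⟩ := hint
    obtain rfl : Φ = fun t => ∫ τ in (0:ℝ)..t, τ * φ τ := funext hΦ
    refine monotoneOn_div_rpow_of_mul_le_mul_deriv (fun t ht =>
      hasDerivAt_integral_of_continuousOn_Ioi (continuousOn_id.mul hφc) ha hint ht)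
      fun t ht => (hφ3 t ht).trans_eq ?_
    rw [Pi.mul_apply, id]
    ring
  · push Not at hint
    intro s hs t ht _
    simp [hΦ, intervalIntegral.integral_undef (hint s hs),
      intervalIntegral.integral_undef (hint t ht)]
end

section
/- Let N ≥ 2 be an integer, s ∈ (0,1), and assume (φ₁), (φ₂) and (φ₃) with constants satisfying 1 < ℓ ≤ m < N/s. Then Φ restricted to [0,∞) is a strictly increasing continuous bijection onto [0,∞); the integral H(t) = ∫₀^t Φ⁻¹(τ)·τ^{−(N+s)/N} dτ is finite for every t ≥ 0; H is a strictly increasing continuous bijection of [0,∞) onto [0,∞); and its inverse Φ*_s := H⁻¹ satisfies min(σ^{ℓ*}, σ^{m*})·Φ*_s(t) ≤ Φ*_s(σ·t) ≤ max(σ^{ℓ*}, σ^{m*})·Φ*_s(t) for all σ ≥ 0 and t ≥ 0, where ℓ* = N·ℓ/(N − s·ℓ) and m* = N·m/(N − s·m). -/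
/-- `f` grows under dilations by `σ ≥ 1` at least like `σ ^ a` and at most like `σ ^ b`. -/
def PowerScaling (f : ℝ → ℝ) (a b : ℝ) : Prop :=
  ∀ σ ≥ (1:ℝ), ∀ t ≥ (0:ℝ), σ ^ a * f t ≤ f (σ * t) ∧ f (σ * t) ≤ σ ^ b * f t

theorem PowerScaling.bijOn {f : ℝ → ℝ} {a b : ℝ} (h : PowerScaling f a b) (ha : 0 < a)
    (hmono : StrictMonoOn f (Set.Ici 0)) (hcont : ContinuousOn f (Set.Ici 0)) (h0 : f 0 = 0) :
    Set.BijOn f (Set.Ici 0) (Set.Ici 0) := by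
  refine ⟨fun t ht => ?_, hmono.injOn, fun y hy => ?_⟩
  · exact h0 ▸ hmono.monotoneOn Set.self_mem_Ici ht ht
  · have h1 : 0 < f 1 := h0 ▸ hmono Set.self_mem_Ici (zero_le_one' ℝ) one_pos
    have htop : Filter.Tendsto (fun σ : ℝ => σ ^ a * f 1) Filter.atTop Filter.atTop :=
      (tendsto_rpow_atTop ha).atTop_mul_const h1
    obtain ⟨σ, hσ, hσy⟩ := ((htop.eventually_ge_atTop y).and
      (Filter.eventually_ge_atTop (1:ℝ))).exists
    have hle : y ≤ f σ := hσ.trans (by simpa using (h σ hσy 1 zero_le_one).1)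
    have hσ0 : (0:ℝ) ≤ σ := zero_le_one.trans hσy
    obtain ⟨x, hx, hxy⟩ := intermediate_value_Icc hσ0 (hcont.mono Set.Icc_subset_Ici_self)
      (show y ∈ Set.Icc (f 0) (f σ) from ⟨h0.symm ▸ Set.mem_Ici.1 hy, hle⟩)
    exact ⟨x, hx.1, hxy⟩

theorem PowerScaling.inverse {f g : ℝ → ℝ} {a b : ℝ} (h : PowerScaling f a b)
    (ha : 0 < a) (hb : 0 < b) (hmono : StrictMonoOn f (Set.Ici 0))
    (hg : ∀ t ≥ (0:ℝ), g t ∈ Set.Ici (0:ℝ) ∧ f (g t) = t) :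
    PowerScaling g b⁻¹ a⁻¹ := by
  intro σ hσ t ht
  have hσ0 : (0:ℝ) ≤ σ := zero_le_one.trans hσ
  obtain ⟨hgt, hfg⟩ := hg t ht
  obtain ⟨hgt', hfg'⟩ := hg (σ * t) (mul_nonneg hσ0 ht)
  have hpow : ∀ c : ℝ, 0 ≤ σ ^ c * g t := fun c => mul_nonneg (Real.rpow_nonneg hσ0 c) hgt
  constructor
  · rw [← hmono.le_iff_le (hpow _) hgt', hfg']
    have := (h (σ ^ b⁻¹) (Real.one_le_rpow hσ (by positivity)) (g t) hgt).2
    rwa [Real.rpow_inv_rpow hσ0 hb.ne', hfg] at this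
  · rw [← hmono.le_iff_le hgt' (hpow _), hfg']
    have := (h (σ ^ a⁻¹) (Real.one_le_rpow hσ (by positivity)) (g t) hgt).1
    rwa [Real.rpow_inv_rpow hσ0 ha.ne', hfg] at this

theorem PowerScaling.exists_inverse {f : ℝ → ℝ} {a b : ℝ} (h : PowerScaling f a b)
    (ha : 0 < a) (hb : 0 < b) (hmono : StrictMonoOn f (Set.Ici 0))
    (hbij : Set.BijOn f (Set.Ici 0) (Set.Ici 0)) (h0 : f 0 = 0) :
    ∃ g : ℝ → ℝ, (∀ t ≥ (0:ℝ), g t ∈ Set.Ici (0:ℝ) ∧ f (g t) = t) ∧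
      (∀ t ≥ (0:ℝ), g (f t) = t) ∧ StrictMonoOn g (Set.Ici 0) ∧ g 0 = 0 ∧
      PowerScaling g b⁻¹ a⁻¹ := by
  have hinv := hbij.invOn_invFunOn
  have hmaps := hbij.surjOn.mapsTo_invFunOn
  have hg : ∀ t ≥ (0:ℝ), Function.invFunOn f (Set.Ici 0) t ∈ Set.Ici (0:ℝ) ∧
      f (Function.invFunOn f (Set.Ici 0) t) = t := fun t ht => ⟨hmaps ht, hinv.2 ht⟩
  refine ⟨Function.invFunOn f (Set.Ici 0), hg, fun t ht => hinv.1 ht, fun x hx y hy hxy => ?_,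
    ?_, h.inverse ha hb hmono hg⟩
  · rwa [← hmono.lt_iff_lt (hmaps hx) (hmaps hy), hinv.2 hx, hinv.2 hy]
  · simpa [h0] using hinv.1 (Set.self_mem_Ici (a := (0:ℝ)))

theorem PowerScaling.min_max {f : ℝ → ℝ} {a b : ℝ} (h : PowerScaling f a b)
    (ha : 0 < a) (hab : a ≤ b) (h0 : f 0 = 0) (hnonneg : ∀ t ≥ (0:ℝ), 0 ≤ f t)
    {σ t : ℝ} (hσ : 0 ≤ σ) (ht : 0 ≤ t) :
    min (σ ^ a) (σ ^ b) * f t ≤ f (σ * t) ∧ f (σ * t) ≤ max (σ ^ a) (σ ^ b) * f t := by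
  have hft := hnonneg t ht
  rcases hσ.eq_or_lt with rfl | hσ
  · simp [Real.zero_rpow ha.ne', Real.zero_rpow (ha.trans_le hab).ne', h0]
  rcases le_total 1 σ with h1 | h1
  · obtain ⟨hl, hr⟩ := h σ h1 t ht
    exact ⟨(mul_le_mul_of_nonneg_right (min_le_left _ _) hft).trans hl,
      hr.trans (mul_le_mul_of_nonneg_right (le_max_right _ _) hft)⟩
  · obtain ⟨hl, hr⟩ := h σ⁻¹ ((one_le_inv₀ hσ).2 h1) (σ * t) (by positivity)
    rw [inv_mul_cancel_left₀ hσ.ne', Real.inv_rpow hσ.le] at hl hr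
    rw [inv_mul_le_iff₀ (by positivity)] at hl
    rw [le_inv_mul_iff₀ (by positivity)] at hr
    exact ⟨(mul_le_mul_of_nonneg_right (min_le_right _ _) hft).trans hr,
      hl.trans (mul_le_mul_of_nonneg_right (le_max_left _ _) hft)⟩

theorem PowerScaling.intervalIntegrable {g : ℝ → ℝ} {a b p : ℝ} (h : PowerScaling g a b)
    (hmono : MonotoneOn g (Set.Ici 0)) (hnonneg : ∀ t ≥ (0:ℝ), 0 ≤ g t) (hap : -1 < a + p)
    {T : ℝ} (hT : 0 ≤ T) :
    IntervalIntegrable (fun τ => g τ * τ ^ p) MeasureTheory.volume 0 T := by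
  rcases hT.eq_or_lt with rfl | hT
  · exact IntervalIntegrable.refl
  refine ((intervalIntegral.intervalIntegrable_rpow' (a := 0) (b := T) hap).const_mul
    (g T * (T ^ a)⁻¹)).mono_fun ?_ ?_
  · have hsub : Set.uIoc 0 T ⊆ Set.Ici 0 := by
      rw [Set.uIoc_of_le hT.le]; exact fun x hx => hx.1.le
    exact ((aemeasurable_restrict_of_monotoneOn measurableSet_uIoc
      (hmono.mono hsub)).mul (by fun_prop)).aestronglyMeasurable
  · refine (MeasureTheory.ae_restrict_mem measurableSet_uIoc).mono fun τ hτ => ?_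
    rw [Set.uIoc_of_le hT.le] at hτ
    obtain ⟨hτ0, hτT⟩ := hτ
    have hgτ := hnonneg τ hτ0.le
    have hgT := hnonneg T hT.le
    have hs := (h (T / τ) ((one_le_div hτ0).2 hτT) τ hτ0.le).1
    rw [div_mul_cancel₀ _ hτ0.ne', Real.div_rpow hT.le hτ0.le] at hs
    have hbound : g τ ≤ g T * (T ^ a)⁻¹ * τ ^ a := by
      have hTa : 0 < T ^ a := by positivity
      have hτa : 0 < τ ^ a := by positivity
      calc g τ = (T ^ a / τ ^ a * g τ) * (T ^ a)⁻¹ * τ ^ a := by field_simp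
        _ ≤ _ := by gcongr
    simp only
    rw [Real.norm_of_nonneg (by positivity), Real.norm_of_nonneg (by positivity),
      Real.rpow_add hτ0, ← mul_assoc]
    gcongr

theorem continuousOn_primitive_Ici {f : ℝ → ℝ}
    (hf : ∀ T ≥ (0:ℝ), IntervalIntegrable f MeasureTheory.volume 0 T) :
    ContinuousOn (fun t => ∫ τ in (0:ℝ)..t, f τ) (Set.Ici 0) := by
  intro x hx
  have hx1 : (0:ℝ) ≤ x + 1 := add_nonneg hx zero_le_one
  have hc := intervalIntegral.continuousOn_primitive_interval'
    (hf (x + 1) hx1) Set.left_mem_uIcc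
  rw [Set.uIcc_of_le hx1] at hc
  refine (hc x ⟨hx, by linarith⟩).mono_of_mem_nhdsWithin ?_
  exact mem_nhdsWithin.2 ⟨Set.Iio (x + 1), isOpen_Iio, by simp,
    fun y hy => ⟨hy.2, hy.1.le⟩⟩

theorem strictMonoOn_primitive_Ici {f : ℝ → ℝ}
    (hf : ∀ T ≥ (0:ℝ), IntervalIntegrable f MeasureTheory.volume 0 T)
    (hpos : ∀ t > (0:ℝ), 0 < f t) :
    StrictMonoOn (fun t => ∫ τ in (0:ℝ)..t, f τ) (Set.Ici 0) := by
  intro x hx y hy hxy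
  have hxy' : IntervalIntegrable f MeasureTheory.volume x y := (hf x hx).symm.trans (hf y hy)
  have hadd := intervalIntegral.integral_add_adjacent_intervals (hf x hx) hxy'
  have := intervalIntegral.intervalIntegral_pos_of_pos_on hxy'
    (fun t ht => hpos t (lt_of_le_of_lt hx ht.1)) hxy
  simp only
  linarith

theorem PowerScaling.primitive {g : ℝ → ℝ} {a b p : ℝ} (h : PowerScaling g a b)
    (hintegrable : ∀ T ≥ (0:ℝ), IntervalIntegrable (fun τ => g τ * τ ^ p) MeasureTheory.volume 0 T) :
    PowerScaling (fun t => ∫ τ in (0:ℝ)..t, g τ * τ ^ p) (a + p + 1) (b + p + 1) := by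
  intro σ hσ t ht
  have hσ0 : 0 < σ := one_pos.trans_le hσ
  have hcomp : IntervalIntegrable (fun τ => g (σ * τ) * (σ * τ) ^ p)
      MeasureTheory.volume 0 t := by
    have := (hintegrable (σ * t) (by positivity)).comp_mul_left (c := σ)
    simpa [hσ0.ne'] using this
  have heq : ∫ τ in (0:ℝ)..σ * t, g τ * τ ^ p
      = σ * ∫ τ in (0:ℝ)..t, g (σ * τ) * (σ * τ) ^ p := by
    have := intervalIntegral.mul_integral_comp_mul_left (a := 0) (b := t)
      (f := fun τ => g τ * τ ^ p) σ
    simpa using this.symm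
  have hconst : ∀ c : ℝ, σ ^ (c + p + 1) * ∫ τ in (0:ℝ)..t, g τ * τ ^ p
      = σ * ∫ τ in (0:ℝ)..t, σ ^ (c + p) * (g τ * τ ^ p) := fun c => by
    rw [intervalIntegral.integral_const_mul, Real.rpow_add_one hσ0.ne']
    ring
  simp only
  rw [heq, hconst, hconst]
  have hpt : ∀ τ ∈ Set.Icc 0 t, σ ^ (a + p) * (g τ * τ ^ p) ≤ g (σ * τ) * (σ * τ) ^ p ∧
      g (σ * τ) * (σ * τ) ^ p ≤ σ ^ (b + p) * (g τ * τ ^ p) := by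
    intro τ hτ
    obtain ⟨hl, hr⟩ := h σ hσ τ hτ.1
    have hτp : 0 ≤ σ ^ p * τ ^ p :=
      mul_nonneg (Real.rpow_nonneg hσ0.le p) (Real.rpow_nonneg hτ.1 p)
    rw [Real.mul_rpow hσ0.le hτ.1, Real.rpow_add hσ0, Real.rpow_add hσ0]
    have hl' := mul_le_mul_of_nonneg_right hl hτp
    have hr' := mul_le_mul_of_nonneg_right hr hτp
    constructor <;> linarith
  exact ⟨mul_le_mul_of_nonneg_left (intervalIntegral.integral_mono_on ht
      ((hintegrable t ht).const_mul _) hcomp fun τ hτ => (hpt τ hτ).1) hσ0.le,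
    mul_le_mul_of_nonneg_left (intervalIntegral.integral_mono_on ht
      hcomp ((hintegrable t ht).const_mul _) fun τ hτ => (hpt τ hτ).2) hσ0.le⟩

/-- A differential inequality `a * f t ≤ t * f' t ≤ b * f t` integrates to power scaling. -/
theorem powerScaling_of_hasDerivAt {f f' : ℝ → ℝ} {a b : ℝ} (h0 : f 0 = 0)
    (hderiv : ∀ t > (0:ℝ), HasDerivAt f (f' t) t)
    (hbound : ∀ t > (0:ℝ), a * f t ≤ t * f' t ∧ t * f' t ≤ b * f t) :
    PowerScaling f a b := by
  have hd : ∀ c : ℝ, ∀ t > (0:ℝ), HasDerivAt (fun t => f t * t ^ (-c))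
      ((t * f' t - c * f t) * t ^ (-c - 1)) t := fun c t ht => by
    have := (hderiv t ht).mul (Real.hasDerivAt_rpow_const (p := -c) (Or.inl ht.ne'))
    refine this.congr_deriv ?_
    have : t ^ (-c) = t ^ (-c - 1) * t := by
      rw [← Real.rpow_add_one ht.ne']; ring_nf
    rw [this]; ring
  have hcont : ∀ c : ℝ, ContinuousOn (fun t => f t * t ^ (-c)) (Set.Ioi 0) :=
    fun c t ht => (hd c t ht).continuousAt.continuousWithinAt
  have hmono : MonotoneOn (fun t => f t * t ^ (-a)) (Set.Ioi 0) := by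
    refine monotoneOn_of_hasDerivWithinAt_nonneg (convex_Ioi 0) (hcont a)
      (fun t ht => (hd a t (interior_subset ht)).hasDerivWithinAt) fun t ht => ?_
    have ht : 0 < t := interior_subset ht
    exact mul_nonneg (sub_nonneg.2 (hbound t ht).1) (by positivity)
  have hanti : AntitoneOn (fun t => f t * t ^ (-b)) (Set.Ioi 0) := by
    refine antitoneOn_of_hasDerivWithinAt_nonpos (convex_Ioi 0) (hcont b)
      (fun t ht => (hd b t (interior_subset ht)).hasDerivWithinAt) fun t ht => ?_
    have ht : 0 < t := interior_subset ht
    exact mul_nonpos_of_nonpos_of_nonneg (sub_nonpos.2 (hbound t ht).2) (by positivity)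
  intro σ hσ t ht
  rcases ht.eq_or_lt with rfl | ht
  · simp [h0]
  have hσ0 : 0 < σ := one_pos.trans_le hσ
  have hσt : 0 < σ * t := mul_pos hσ0 ht
  have hle : t ≤ σ * t := le_mul_of_one_le_left ht.le hσ
  have hm := hmono ht hσt hle
  have ha := hanti ht hσt hle
  simp only [Real.mul_rpow hσ0.le ht.le, ← mul_assoc] at hm ha
  have hm := le_of_mul_le_mul_right hm (by positivity)
  have ha := le_of_mul_le_mul_right ha (by positivity)
  rw [Real.rpow_neg hσ0.le, ← div_eq_mul_inv] at hm ha
  rw [le_div_iff₀ (by positivity)] at hm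
  rw [div_le_iff₀ (by positivity)] at ha
  constructor <;> linarith


/-- Fractional Sobolev conjugate: for `N ≥ 2`, `s ∈ (0,1)`, and (φ₁)–(φ₃) with
`1 < ℓ ≤ m < N/s`, the function `Φ` is a strictly increasing continuous bijection of
`[0,∞)` onto itself; the integral `H(t) = ∫₀ᵗ Φ⁻¹(τ)·τ^{−(N+s)/N} dτ` is finite for every
`t ≥ 0`; `H` is a strictly increasing continuous bijection of `[0,∞)` onto `[0,∞)`; and
its inverse `Φ*_s = H⁻¹` satisfies
`min(σ^{ℓ*}, σ^{m*})·Φ*_s(t) ≤ Φ*_s(σt) ≤ max(σ^{ℓ*}, σ^{m*})·Φ*_s(t)` with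
`ℓ* = Nℓ/(N − sℓ)`, `m* = Nm/(N − sm)`. -/
theorem stmt11 (N : ℕ) (hN : 2 ≤ N) (s : ℝ) (hs : s ∈ Set.Ioo (0:ℝ) 1)
    (φ Φ : ℝ → ℝ) (ℓ m : ℝ)
    (hφc : ContinuousOn φ (Set.Ioi 0))
    (hφ0 : ∀ t > (0:ℝ), 0 ≤ φ t)
    (hΦ : ∀ t, Φ t = ∫ τ in (0:ℝ)..t, τ * φ τ)
    (hφ1a : Filter.Tendsto (fun τ => τ * φ τ) (nhdsWithin 0 (Set.Ioi 0)) (nhds 0))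
    (hφ1b : Filter.Tendsto (fun τ => τ * φ τ) Filter.atTop Filter.atTop)
    (hφ2 : MonotoneOn (fun τ => τ * φ τ) (Set.Ioi 0))
    (hℓ : 1 < ℓ) (hℓm : ℓ ≤ m) (hm : m < N / s)
    (hφ3 : ∀ t > (0:ℝ), 0 < Φ t ∧ ℓ * Φ t ≤ t ^ 2 * φ t ∧ t ^ 2 * φ t ≤ m * Φ t) :
    StrictMonoOn Φ (Set.Ici 0) ∧ ContinuousOn Φ (Set.Ici 0) ∧
    Set.BijOn Φ (Set.Ici 0) (Set.Ici 0) ∧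
    ∃ Φinv : ℝ → ℝ,
      (∀ t ≥ (0:ℝ), Φinv t ∈ Set.Ici (0:ℝ) ∧ Φ (Φinv t) = t) ∧
      (∀ t ≥ (0:ℝ), Φinv (Φ t) = t) ∧
      (∀ t ≥ (0:ℝ), IntervalIntegrable
        (fun τ => Φinv τ * τ ^ (-((N:ℝ) + s) / N)) MeasureTheory.volume 0 t) ∧
      (StrictMonoOn (fun t => ∫ τ in (0:ℝ)..t, Φinv τ * τ ^ (-((N:ℝ) + s) / N))
          (Set.Ici 0) ∧
        ContinuousOn (fun t => ∫ τ in (0:ℝ)..t, Φinv τ * τ ^ (-((N:ℝ) + s) / N))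
          (Set.Ici 0) ∧
        Set.BijOn (fun t => ∫ τ in (0:ℝ)..t, Φinv τ * τ ^ (-((N:ℝ) + s) / N))
          (Set.Ici 0) (Set.Ici 0)) ∧
      ∃ Φstar : ℝ → ℝ,
        (∀ t ≥ (0:ℝ), Φstar t ∈ Set.Ici (0:ℝ) ∧
          (∫ τ in (0:ℝ)..(Φstar t), Φinv τ * τ ^ (-((N:ℝ) + s) / N)) = t) ∧
        (∀ t ≥ (0:ℝ),
          Φstar (∫ τ in (0:ℝ)..t, Φinv τ * τ ^ (-((N:ℝ) + s) / N)) = t) ∧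
        ∀ σ ≥ (0:ℝ), ∀ t ≥ (0:ℝ),
          min (σ ^ ((N:ℝ) * ℓ / (N - s * ℓ))) (σ ^ ((N:ℝ) * m / (N - s * m))) * Φstar t
              ≤ Φstar (σ * t) ∧
          Φstar (σ * t)
              ≤ max (σ ^ ((N:ℝ) * ℓ / (N - s * ℓ))) (σ ^ ((N:ℝ) * m / (N - s * m))) *
                  Φstar t := by
  obtain ⟨hs0, hs1⟩ := hs
  have hN0 : (0:ℝ) < N := by exact_mod_cast (by lia : 0 < N)
  have hm0 : 0 < m := by linarith
  have hl0 : 0 < ℓ := by linarith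
  have hsm : s * m < N := by rw [lt_div_iff₀ hs0] at hm; linarith
  have hsl : s * ℓ < N := (mul_le_mul_of_nonneg_left hℓm hs0.le).trans_lt hsm
  have hpos : ∀ t > (0:ℝ), 0 < t * φ t := fun t ht => by
    obtain ⟨h1, h2, -⟩ := hφ3 t ht
    have : 0 < t * (t * φ t) := by nlinarith [mul_pos hl0 h1]
    exact pos_of_mul_pos_right this ht.le
  have hgmono : MonotoneOn (fun τ => τ * φ τ) (Set.Ici 0) := by
    intro x hx y hy hxy
    rcases eq_or_lt_of_le (Set.mem_Ici.1 hx) with rfl | hx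
    · rcases eq_or_lt_of_le (Set.mem_Ici.1 hy) with rfl | hy
      · exact le_rfl
      · simpa using (hpos y hy).le
    · exact hφ2 hx (hx.trans_le hxy) hxy
  have hgintegrable : ∀ T ≥ (0:ℝ), IntervalIntegrable (fun τ => τ * φ τ)
      MeasureTheory.volume 0 T := fun T hT =>
    (hgmono.mono (by rw [Set.uIcc_of_le hT]; exact Set.Icc_subset_Ici_self)).intervalIntegrable
  obtain rfl : Φ = fun t => ∫ τ in (0:ℝ)..t, τ * φ τ := funext hΦ
  clear hΦ
  set Φ : ℝ → ℝ := fun t => ∫ τ in (0:ℝ)..t, τ * φ τ with hΦ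
  have hΦ0 : Φ 0 = 0 := by simp [hΦ]
  have hΦcont : ContinuousOn Φ (Set.Ici 0) := continuousOn_primitive_Ici hgintegrable
  have hΦmono : StrictMonoOn Φ (Set.Ici 0) := strictMonoOn_primitive_Ici hgintegrable hpos
  have hgcont : ContinuousOn (fun τ => τ * φ τ) (Set.Ioi 0) := continuousOn_id.mul hφc
  have hΦscale : PowerScaling Φ ℓ m := by
    refine powerScaling_of_hasDerivAt (f' := fun t => t * φ t) hΦ0 (fun t ht => ?_) fun t ht => ?_
    · exact intervalIntegral.integral_hasDerivAt_right (hgintegrable t ht.le)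
        (hgcont.stronglyMeasurableAtFilter isOpen_Ioi t ht)
        (hgcont.continuousAt (Ioi_mem_nhds ht))
    · obtain ⟨-, h1, h2⟩ := hφ3 t ht
      constructor <;> nlinarith
  have hΦbij := hΦscale.bijOn hl0 hΦmono hΦcont hΦ0
  obtain ⟨Φinv, hinv, hinv', hinvmono, hinv0, hinvscale⟩ :=
    hΦscale.exists_inverse hl0 hm0 hΦmono hΦbij hΦ0
  refine ⟨hΦmono, hΦcont, hΦbij, Φinv, hinv, hinv', ?_⟩
  set p : ℝ := -((N:ℝ) + s) / N with hp
  have hmexp : m⁻¹ + p + 1 = ((N:ℝ) * m / (N - s * m))⁻¹ := by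
    rw [hp]; field_simp; ring
  have hlexp : ℓ⁻¹ + p + 1 = ((N:ℝ) * ℓ / (N - s * ℓ))⁻¹ := by
    rw [hp]; field_simp; ring
  have hmstar : 0 < (N:ℝ) * m / (N - s * m) := div_pos (by positivity) (by linarith)
  have hlstar : 0 < (N:ℝ) * ℓ / (N - s * ℓ) := div_pos (by positivity) (by linarith)
  have hle : (N:ℝ) * ℓ / (N - s * ℓ) ≤ (N:ℝ) * m / (N - s * m) := by
    gcongr
  have hintegrable : ∀ t ≥ (0:ℝ), IntervalIntegrable (fun τ => Φinv τ * τ ^ p)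
      MeasureTheory.volume 0 t := fun t ht =>
    hinvscale.intervalIntegrable hinvmono.monotoneOn (fun t ht => (hinv t ht).1)
      (by have := inv_pos.2 hmstar; linarith) ht
  have hHscale := hinvscale.primitive hintegrable
  rw [hmexp, hlexp] at hHscale
  have hHmono := strictMonoOn_primitive_Ici hintegrable fun t ht => mul_pos
    (hinv0 ▸ hinvmono Set.self_mem_Ici (Set.mem_Ici.2 ht.le) ht) (Real.rpow_pos_of_pos ht p)
  have hHcont := continuousOn_primitive_Ici hintegrable
  have hHbij := hHscale.bijOn (inv_pos.2 hmstar) hHmono hHcont intervalIntegral.integral_same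
  obtain ⟨Φstar, hstar, hstar', -, hstar0, hstarscale⟩ := hHscale.exists_inverse
    (inv_pos.2 hmstar) (inv_pos.2 hlstar) hHmono hHbij intervalIntegral.integral_same
  rw [inv_inv, inv_inv] at hstarscale
  exact ⟨hintegrable, ⟨hHmono, hHcont, hHbij⟩, Φstar, hstar, hstar', fun σ hσ t ht =>
    hstarscale.min_max hlstar hle hstar0 (fun t ht => (hstar t ht).1) hσ ht⟩
end

section
/- Let ψ : (0,∞) → [0,∞) be continuous with τ ↦ τ·ψ(τ) nondecreasing on (0,∞) and τ·ψ(τ) → 0 as τ → 0⁺, let Ψ(t) = ∫₀^t τ·ψ(τ) dτ, and suppose there are constants 1 < ℓ_Ψ ≤ m_Ψ < ∞ with Ψ(t) > 0 and ℓ_Ψ·Ψ(t) ≤ t²·ψ(t) ≤ m_Ψ·Ψ(t) for all t > 0. Let Ψ̃(u) = sup_{s ≥ 0} (u·s − Ψ(s)). Then for every C > 0 there exist constants C₁, C₂ > 0 such that Ψ̃(C·(1 + t·ψ(t))) ≤ C₁ + C₂·Ψ(t) for all t > 0. -/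
/-- The primitive from `0` of a function that is continuous on `(0, ∞)` and tends to `0 = g 0` at
`0⁺` is differentiable on `(0, ∞)` with derivative `g`. -/
theorem hasDerivAt_primitive_of_tendsto_zero {g F : ℝ → ℝ} (hg : ContinuousOn g (Set.Ioi 0))
    (h0 : Filter.Tendsto g (nhdsWithin 0 (Set.Ioi 0)) (nhds (g 0)))
    (hF : ∀ t, F t = ∫ τ in (0:ℝ)..t, g τ) {t : ℝ} (ht : 0 < t) : HasDerivAt F (g t) t := by
  have hcont : ContinuousOn g (Set.Ici 0) := by
    intro x hx
    rcases (Set.mem_Ici.1 hx).eq_or_lt with rfl | hx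
    · exact continuousWithinAt_Ioi_iff_Ici.1 h0
    · exact (hg.continuousAt (Ioi_mem_nhds hx)).continuousWithinAt
  have hint : IntervalIntegrable g MeasureTheory.volume 0 t :=
    (hcont.mono (by rw [Set.uIcc_of_le ht.le]; exact Set.Icc_subset_Ici_self)).intervalIntegrable
  rw [funext hF]
  exact intervalIntegral.integral_hasDerivAt_right hint
    (hg.stronglyMeasurableAtFilter isOpen_Ioi t ht) (hg.continuousAt (Ioi_mem_nhds ht))

theorem hasDerivAt_rpow_neg_mul_s17 {F : ℝ → ℝ} {d t : ℝ} (a : ℝ) (ht : 0 < t)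
    (hF : HasDerivAt F d t) :
    HasDerivAt (fun s => s ^ (-a) * F s) (t ^ (-a - 1) * (t * d - a * F t)) t := by
  refine ((Real.hasDerivAt_rpow_const (p := -a) (Or.inl ht.ne')).mul hF).congr_deriv ?_
  rw [Real.rpow_sub_one ht.ne']
  field_simp
  ring

/-- If `a * F t ≤ t * F' t` on `(0, ∞)`, then `F` grows at least like the power `a`. -/
theorem rpow_mul_le_of_mul_le_mul_deriv {F g : ℝ → ℝ} {a : ℝ}
    (hF : ∀ t > 0, HasDerivAt F (g t) t) (h : ∀ t > 0, a * F t ≤ t * g t)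
    {c t : ℝ} (hc : 1 ≤ c) (ht : 0 < t) : c ^ a * F t ≤ F (c * t) := by
  have hd := fun x (hx : 0 < x) => hasDerivAt_rpow_neg_mul_s17 a hx (hF x hx)
  have hmono : MonotoneOn (fun s => s ^ (-a) * F s) (Set.Ioi 0) := by
    refine monotoneOn_of_deriv_nonneg (convex_Ioi 0)
      (fun x hx => (hd x hx).continuousAt.continuousWithinAt) ?_ ?_ <;> rw [interior_Ioi]
    · exact fun x hx => (hd x hx).differentiableAt.differentiableWithinAt
    · intro x hx
      rw [(hd x hx).deriv]
      exact mul_nonneg (Real.rpow_nonneg (le_of_lt hx) _) (sub_nonneg.2 (h x hx))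
  have hc0 : 0 < c := one_pos.trans_le hc
  have key := hmono (Set.mem_Ioi.2 ht) (Set.mem_Ioi.2 (mul_pos hc0 ht))
    (le_mul_of_one_le_left ht.le hc)
  simp only [Real.mul_rpow hc0.le ht.le, Real.rpow_neg hc0.le, Real.rpow_neg ht.le] at key
  have hca := Real.rpow_pos_of_pos hc0 a
  have hta := Real.rpow_pos_of_pos ht a
  field_simp at key
  linarith

/-- If `t * F' t ≤ a * F t` on `(0, ∞)`, then `F` grows at most like the power `a`. -/
theorem le_rpow_mul_of_mul_deriv_le_mul {F g : ℝ → ℝ} {a : ℝ}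
    (hF : ∀ t > 0, HasDerivAt F (g t) t) (h : ∀ t > 0, t * g t ≤ a * F t)
    {c t : ℝ} (hc : 1 ≤ c) (ht : 0 < t) : F (c * t) ≤ c ^ a * F t := by
  have := rpow_mul_le_of_mul_le_mul_deriv (F := -F) (g := -g) (a := a)
    (fun t ht => (hF t ht).neg) (fun t ht => by simpa using h t ht) hc ht
  simpa using this

/-- A function with monotone derivative on `(0, ∞)` lies above its tangents. -/
theorem mul_sub_le_sub_of_monotoneOn_deriv {F g : ℝ → ℝ} (hF : ∀ t > 0, HasDerivAt F (g t) t)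
    (hg : MonotoneOn g (Set.Ioi 0)) {s t : ℝ} (hs : 0 < s) (ht : 0 < t) :
    g t * (s - t) ≤ F s - F t := by
  rcases lt_trichotomy s t with hst | rfl | hst
  · obtain ⟨x, hx, he⟩ := exists_hasDerivAt_eq_slope F g hst
      (fun y hy => (hF y (hs.trans_le hy.1)).continuousAt.continuousWithinAt)
      (fun y hy => hF y (hs.trans hy.1))
    have hgx : g x ≤ g t := hg (hs.trans hx.1) ht hx.2.le
    rw [he, div_le_iff₀ (sub_pos.2 hst)] at hgx
    linarith
  · simp
  · obtain ⟨x, hx, he⟩ := exists_hasDerivAt_eq_slope F g hst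
      (fun y hy => (hF y (ht.trans_le hy.1)).continuousAt.continuousWithinAt)
      (fun y hy => hF y (ht.trans hy.1))
    have hgx : g t ≤ g x := hg ht (ht.trans hx.1) hx.1.le
    rwa [he, le_div_iff₀ (sub_pos.2 hst)] at hgx


/-- If `Ψ(t) = ∫₀ᵗ τ·ψ(τ) dτ` satisfies the index condition
`ℓ_Ψ·Ψ(t) ≤ t²·ψ(t) ≤ m_Ψ·Ψ(t)` with `1 < ℓ_Ψ ≤ m_Ψ`, and `Ψ̃` is the Young conjugate of
`Ψ`, then for every `C > 0` there are `C₁, C₂ > 0` with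
`Ψ̃(C·(1 + t·ψ(t))) ≤ C₁ + C₂·Ψ(t)` for all `t > 0`. -/
theorem stmt17 (ψ Ψ : ℝ → ℝ) (ℓΨ mΨ : ℝ)
    (hψc : ContinuousOn ψ (Set.Ioi 0))
    (hψ0 : ∀ t > (0:ℝ), 0 ≤ ψ t)
    (hψ2 : MonotoneOn (fun τ => τ * ψ τ) (Set.Ioi 0))
    (hψ1 : Filter.Tendsto (fun τ => τ * ψ τ) (nhdsWithin 0 (Set.Ioi 0)) (nhds 0))
    (hΨ : ∀ t, Ψ t = ∫ τ in (0:ℝ)..t, τ * ψ τ)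
    (hℓ : 1 < ℓΨ) (hℓm : ℓΨ ≤ mΨ)
    (hidx : ∀ t > (0:ℝ), 0 < Ψ t ∧ ℓΨ * Ψ t ≤ t ^ 2 * ψ t ∧ t ^ 2 * ψ t ≤ mΨ * Ψ t) :
    ∀ C > (0:ℝ), ∃ C₁ > (0:ℝ), ∃ C₂ > (0:ℝ), ∀ t > (0:ℝ),
      sSup ((fun s => C * (1 + t * ψ t) * s - Ψ s) '' Set.Ici 0) ≤ C₁ + C₂ * Ψ t := by
  intro C hC
  obtain ⟨g, hg⟩ : ∃ g : ℝ → ℝ, g = fun τ => τ * ψ τ := ⟨_, rfl⟩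
  have hgt (t : ℝ) : t * ψ t = g t := by rw [hg]
  have hsq (t : ℝ) : t ^ 2 * ψ t = t * g t := by rw [← hgt]; ring
  simp only [hgt, hsq] at hψ2 hψ1 hΨ hidx ⊢
  have hg0 : g 0 = 0 := by rw [← hgt, zero_mul]
  have hΨ0 : Ψ 0 = 0 := by simp [hΨ]
  have hder : ∀ t > 0, HasDerivAt Ψ (g t) t := fun t ht =>
    hasDerivAt_primitive_of_tendsto_zero (hg ▸ continuousOn_id.mul hψc) (by rwa [hg0]) hΨ ht
  have hlow : ∀ t > 0, ℓΨ * Ψ t ≤ t * g t := fun t ht => (hidx t ht).2.1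
  have hupp : ∀ t > 0, t * g t ≤ mΨ * Ψ t := fun t ht => (hidx t ht).2.2
  have hΨpos : ∀ t > 0, 0 < Ψ t := fun t ht => (hidx t ht).1
  have hm : 1 < mΨ := hℓ.trans_le hℓm
  have hg1 : 0 < g 1 := by nlinarith [hlow 1 one_pos, hΨpos 1 one_pos]
  obtain ⟨K, hK⟩ : ∃ K, K = C * (1 / g 1 + 1) := ⟨_, rfl⟩
  obtain ⟨c, hc, hcK⟩ : ∃ c : ℝ, 1 ≤ c ∧ K * mΨ ≤ c ^ (ℓΨ - 1) :=
    ((Filter.eventually_ge_atTop 1).and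
      ((tendsto_rpow_atTop (sub_pos.2 hℓ)).eventually_ge_atTop (K * mΨ))).exists
  have hc0 : 0 < c := one_pos.trans_le hc
  have hgrow : ∀ T > 0, K * g T ≤ g (c * T) := by
    intro T hT
    have h1 := rpow_mul_le_of_mul_le_mul_deriv hder hlow hc hT
    have hcT := mul_pos hc0 hT
    have h2 := hlow _ hcT
    have h3 : Ψ (c * T) ≤ c * T * g (c * T) := by nlinarith [hΨpos _ hcT]
    have h4 : c ^ ℓΨ = c * c ^ (ℓΨ - 1) := by
      rw [Real.rpow_sub_one hc0.ne']; field_simp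
    have h5 : K * mΨ * Ψ T ≤ c ^ (ℓΨ - 1) * Ψ T :=
      mul_le_mul_of_nonneg_right hcK (hΨpos T hT).le
    have hK0 : 0 ≤ K := by rw [hK]; positivity
    have h6 : K * (T * g T) ≤ K * (mΨ * Ψ T) := mul_le_mul_of_nonneg_left (hupp T hT) hK0
    have h7 : c * (c ^ (ℓΨ - 1) * Ψ T) ≤ c * (T * g (c * T)) := by
      rw [h4] at h1; linarith
    have h8 := le_of_mul_le_mul_left h7 hc0
    exact le_of_mul_le_mul_left (by linarith : T * (K * g T) ≤ T * g (c * T)) hT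
  have hyoung : ∀ s ≥ 0, ∀ T > 0, g T * s ≤ Ψ s + (mΨ - 1) * Ψ T := by
    intro s hs T hT
    rcases (ge_iff_le.1 hs).eq_or_lt with rfl | hs
    · simpa [hΨ0] using mul_nonneg (sub_pos.2 hm).le (hΨpos T hT).le
    · have := mul_sub_le_sub_of_monotoneOn_deriv hder hψ2 hs hT
      linarith [hupp T hT]
  have hA : 0 < (mΨ - 1) * c ^ mΨ := mul_pos (sub_pos.2 hm) (Real.rpow_pos_of_pos hc0 _)
  refine ⟨(mΨ - 1) * c ^ mΨ * Ψ 1, mul_pos hA (hΨpos 1 one_pos), (mΨ - 1) * c ^ mΨ, hA, ?_⟩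
  intro t ht
  refine csSup_le (Set.nonempty_Ici.image _) ?_
  rintro _ ⟨s, hs, rfl⟩
  obtain ⟨T, hT, h1T, htT, hΨT⟩ : ∃ T > 0, g 1 ≤ g T ∧ g t ≤ g T ∧ Ψ T ≤ Ψ 1 + Ψ t := by
    rcases le_total t 1 with h | h
    · exact ⟨1, one_pos, le_rfl, hψ2 ht (Set.mem_Ioi.2 one_pos) h, by linarith [hΨpos t ht]⟩
    · exact ⟨t, ht, hψ2 (Set.mem_Ioi.2 one_pos) ht h, le_rfl, by linarith [hΨpos 1 one_pos]⟩
  have hle : C * (1 + g t) ≤ g (c * T) := by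
    refine le_trans ?_ (hgrow T hT)
    rw [hK, mul_assoc]
    refine mul_le_mul_of_nonneg_left ?_ hC.le
    have : 1 ≤ 1 / g 1 * g T := by
      rw [one_div_mul_eq_div]
      exact (one_le_div hg1).2 h1T
    linarith
  have h1 := mul_le_mul_of_nonneg_right hle (Set.mem_Ici.1 hs)
  have h2 := hyoung s hs (c * T) (mul_pos hc0 hT)
  have h3 : (mΨ - 1) * Ψ (c * T) ≤ (mΨ - 1) * (c ^ mΨ * Ψ T) :=
    mul_le_mul_of_nonneg_left (le_rpow_mul_of_mul_deriv_le_mul hder hupp hc hT) (sub_pos.2 hm).le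
  have h4 := mul_le_mul_of_nonneg_left hΨT hA.le
  dsimp only
  linarith
end
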